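/- arXiv:1504.06071 — 2 statements merged into one kernel-verified Lean document; each statement's English description precedes it below -/
import Mathlib

section
/- Let q be a power of an odd prime and let A = 𝔽_q[T] be the polynomial ring over the field with q elements. Then SL₂(A) is a polynomial family with 52 parameters: there exist polynomials P₁, P₂, P₃, P₄ in 52 variables with coefficients in A such that the set of quadruples (P₁(x), P₂(x), P₃(x), P₄(x)), as x ranges over A⁵², is exactly the set of quadruples (a, b, c, d) ∈ A⁴ with a·d − b·c = 1. -/
open Polynomial
open scoped Pointwise MatrixGroups

namespace PolyFamily

section Counting
variable (F : Type*) [Field F] [Finite F]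

theorem finite_degreeLT (n : ℕ) : (degreeLT F n : Set F[X]).Finite :=
  Finite.of_equiv _ (degreeLTEquiv F n).symm.toEquiv

theorem ncard_degreeLT (F : Type*) [Field F] (n : ℕ) :
    (degreeLT F n : Set F[X]).ncard = Nat.card F ^ n := by
  rw [← Nat.card_coe_set_eq]
  exact (Nat.card_congr (degreeLTEquiv F n).toEquiv).trans (by simp [Nat.card_fun])

theorem setOf_monic_eq (F : Type*) [Field F] (n : ℕ) :
    {f : F[X] | f.Monic ∧ f.natDegree = n} = Set.image (X ^ n + ·) (degreeLT F n : Set F[X]) := by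
  ext f
  constructor
  · rintro ⟨hf, rfl⟩
    refine ⟨f - X ^ f.natDegree, ?_, by simp⟩
    rw [SetLike.mem_coe, mem_degreeLT]
    have := degree_sub_lt_left (p := f) (q := X ^ f.natDegree)
      (by rw [degree_X_pow, degree_eq_natDegree hf.ne_zero]) hf.ne_zero (by simp [hf])
    rwa [degree_eq_natDegree hf.ne_zero] at this
  · rintro ⟨g, hg, rfl⟩
    rw [SetLike.mem_coe, mem_degreeLT] at hg
    exact ⟨monic_X_pow_add hg, by
      rw [natDegree_add_eq_left_of_degree_lt (by rwa [degree_X_pow]), natDegree_X_pow]⟩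

theorem finite_monic (n : ℕ) : {f : F[X] | f.Monic ∧ f.natDegree = n}.Finite := by
  rw [setOf_monic_eq]
  exact (finite_degreeLT F n).image _

/-- The monic polynomials of degree `n`. -/
noncomputable def monics (n : ℕ) : Finset F[X] := (finite_monic F n).toFinset

variable {F} in

theorem mem_monics {n : ℕ} {f : F[X]} : f ∈ monics F n ↔ f.Monic ∧ f.natDegree = n := by
  simp [monics]

theorem card_monics (n : ℕ) : (monics F n).card = Nat.card F ^ n := by
  rw [monics, ← Set.ncard_eq_toFinset_card _ (finite_monic F n), setOf_monic_eq,
    Set.ncard_image_of_injective _ (add_right_injective _), ncard_degreeLT]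

theorem finite_primePowers (n : ℕ) :
    {x : F[X] × ℕ | x.1.Monic ∧ Irreducible x.1 ∧ x.2 ≠ 0 ∧ x.2 * x.1.natDegree = n}.Finite := by
  refine ((finite_degreeLT F (n + 1)).prod (Set.finite_Iic n)).subset ?_
  rintro ⟨P, k⟩ ⟨-, hP, hk, rfl⟩
  refine ⟨?_, Nat.le_mul_of_pos_right k hP.natDegree_pos⟩
  rw [SetLike.mem_coe, mem_degreeLT, degree_eq_natDegree hP.ne_zero]
  exact_mod_cast Nat.lt_succ_of_le (Nat.le_mul_of_pos_left P.natDegree (Nat.pos_of_ne_zero hk))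

/-- The pairs `(P, k)` with `P` monic irreducible and `P ^ k` of degree `n`, `k ≠ 0`. -/
noncomputable def primePowers (n : ℕ) : Finset (F[X] × ℕ) := (finite_primePowers F n).toFinset

variable {F} in

theorem mem_primePowers {n : ℕ} {x : F[X] × ℕ} : x ∈ primePowers F n ↔
    x.1.Monic ∧ Irreducible x.1 ∧ x.2 ≠ 0 ∧ x.2 * x.1.natDegree = n := by
  simp [primePowers]

variable {F}

open Classical in

/-- The degree of a monic polynomial as a sum over the prime powers dividing it. -/
theorem sum_primePowers_dvd {n : ℕ} {f : F[X]} (hf : f ∈ monics F n) :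
    ∑ p ∈ Finset.HasAntidiagonal.antidiagonal n, ∑ x ∈ primePowers F p.2 with x.1 ^ x.2 ∣ f,
      x.1.natDegree = n := by
  rw [mem_monics] at hf
  obtain ⟨hf, rfl⟩ := hf
  set s := UniqueFactorizationMonoid.normalizedFactors f with hs
  have hcount {P : F[X]} (hP : Irreducible P) (hm : P.Monic) (k : ℕ) :
      P ^ k ∣ f ↔ k ≤ s.count P := by
    rw [pow_dvd_iff_le_emultiplicity,
      UniqueFactorizationMonoid.emultiplicity_eq_count_normalizedFactors hP hf.ne_zero,
      hm.normalize_eq_self, Nat.cast_le]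
  have hdeg : f.natDegree = ∑ P ∈ s.toFinset, ∑ k ∈ Finset.Icc 1 (s.count P), P.natDegree := by
    have h0 : 0 ∉ s := UniqueFactorizationMonoid.zero_notMem_normalizedFactors f
    have hprod : s.prod = f := by
      have := leadingCoeff_mul_prod_normalizedFactors f
      rwa [hf.leadingCoeff, map_one, one_mul] at this
    conv_lhs => rw [← hprod, natDegree_multiset_prod _ h0, Finset.sum_multiset_map_count]
    simp
  conv_rhs => rw [hdeg]
  rw [Finset.sum_sigma', Finset.sum_sigma']
  refine Finset.sum_bij' (fun y _ => ⟨y.2.1, y.2.2⟩)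
    (fun z _ => ⟨(f.natDegree - z.2 * z.1.natDegree, z.2 * z.1.natDegree), (z.1, z.2)⟩)
    ?_ ?_ ?_ ?_ ?_
  · rintro ⟨⟨i, j⟩, P, k⟩ h
    simp only [Finset.mem_sigma, Finset.HasAntidiagonal.mem_antidiagonal, Finset.mem_filter,
      mem_primePowers] at h
    obtain ⟨-, ⟨hm, hP, hk, -⟩, hd⟩ := h
    rw [hcount hP hm] at hd
    simp only [Finset.mem_sigma, Finset.mem_Icc, Multiset.mem_toFinset]
    exact ⟨Multiset.count_pos.mp (by omega), by omega, hd⟩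
  · rintro ⟨P, k⟩ h
    simp only [Finset.mem_sigma, Finset.mem_Icc, Multiset.mem_toFinset] at h
    obtain ⟨hPs, hk, hd⟩ := h
    rw [hs, Polynomial.mem_normalizedFactors_iff hf.ne_zero] at hPs
    rw [← hcount hPs.1 hPs.2.1] at hd
    simp only [Finset.mem_sigma, Finset.HasAntidiagonal.mem_antidiagonal, Finset.mem_filter,
      mem_primePowers]
    have := natDegree_le_of_dvd hd hf.ne_zero
    rw [natDegree_pow] at this
    exact ⟨by omega, ⟨hPs.2.1, hPs.1, by omega, trivial⟩, hd⟩
  · rintro ⟨⟨i, j⟩, P, k⟩ h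
    simp only [Finset.mem_sigma, Finset.HasAntidiagonal.mem_antidiagonal, Finset.mem_filter,
      mem_primePowers] at h
    obtain ⟨hij, ⟨hm, hP, hk, rfl⟩, hd⟩ := h
    simp only [← hij]
    congr
    omega
  · rintro ⟨P, k⟩ h
    rfl
  · rintro ⟨⟨i, j⟩, P, k⟩ h
    rfl

open Classical in

theorem sum_monics_dvd (χ : F[X] →* ℂ) {i j : ℕ} {f : F[X]} (hf : f ∈ monics F j) :
    ∑ g ∈ monics F (i + j) with f ∣ g, χ g = (∑ g ∈ monics F i, χ g) * χ f := by
  rw [mem_monics] at hf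
  rw [Finset.sum_mul]
  symm
  refine Finset.sum_bij (fun g _ => g * f) ?_ ?_ ?_ ?_
  · intro g hg
    rw [mem_monics] at hg
    rw [Finset.mem_filter, mem_monics]
    exact ⟨⟨hg.1.mul hf.1, by rw [hg.1.natDegree_mul hf.1, hg.2, hf.2]⟩, dvd_mul_left _ _⟩
  · intro g _ g' _ h
    exact mul_right_cancel₀ hf.1.ne_zero h
  · intro g hg
    rw [Finset.mem_filter, mem_monics] at hg
    obtain ⟨⟨hg, hd⟩, k, rfl⟩ := hg
    have hk : k.Monic := hf.1.of_mul_monic_left hg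
    rw [hf.1.natDegree_mul hk] at hd
    exact ⟨k, mem_monics.mpr ⟨hk, by omega⟩, mul_comm _ _⟩
  · intro g _
    rw [map_mul]

/-- The generating series of a completely multiplicative function over monic polynomials. -/
noncomputable def lSeries (χ : F[X] →* ℂ) : PowerSeries ℂ :=
  PowerSeries.mk fun n => ∑ f ∈ monics F n, χ f

/-- The generating series of a completely multiplicative function over prime powers, weighted by
the von Mangoldt function. -/
noncomputable def primeSeries (χ : F[X] →* ℂ) : PowerSeries ℂ :=
  PowerSeries.mk fun n => ∑ x ∈ primePowers F n, x.1.natDegree * χ (x.1 ^ x.2)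

/-- `Λ` is the logarithmic derivative of `L` for the derivation `X d/dX`. -/
def IsLogDeriv (L Λ : PowerSeries ℂ) : Prop :=
  ∀ n : ℕ, (n : ℂ) * L.coeff n = (L * Λ).coeff n

theorem isLogDeriv_lSeries (χ : F[X] →* ℂ) : IsLogDeriv (lSeries χ) (primeSeries χ) := by
  classical
  intro n
  rw [PowerSeries.coeff_mul, lSeries, primeSeries, PowerSeries.coeff_mk, Finset.mul_sum]
  have h1 : ∀ f ∈ monics F n, (n : ℂ) * χ f = ∑ p ∈ Finset.HasAntidiagonal.antidiagonal n,
      ∑ x ∈ primePowers F p.2 with x.1 ^ x.2 ∣ f, (x.1.natDegree * χ f) := by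
    intro f hf
    conv_lhs => rw [← sum_primePowers_dvd hf]
    push_cast
    simp only [Finset.sum_mul]
  rw [Finset.sum_congr rfl h1, Finset.sum_comm]
  refine Finset.sum_congr rfl fun p hp => ?_
  rw [Finset.HasAntidiagonal.mem_antidiagonal] at hp
  simp only [PowerSeries.coeff_mk, Finset.sum_filter]
  rw [Finset.sum_comm, Finset.mul_sum]
  refine Finset.sum_congr rfl fun x hx => ?_
  rw [mem_primePowers] at hx
  rw [← Finset.sum_filter, ← Finset.mul_sum, ← hp, sum_monics_dvd χ, mul_left_comm]
  rw [mem_monics]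
  exact ⟨hx.1.pow _, by rw [natDegree_pow, hx.2.2.2]⟩

end Counting

section LogDeriv

theorem isLogDeriv_iff {L Λ : PowerSeries ℂ} :
    IsLogDeriv L Λ ↔ PowerSeries.X * PowerSeries.derivative ℂ L = L * Λ := by
  rw [PowerSeries.ext_iff]
  refine forall_congr' fun n => ?_
  rw [eq_comm, eq_comm (b := PowerSeries.coeff n (L * Λ))]
  cases n with
  | zero => simp
  | succ n => simp [PowerSeries.coeff_succ_X_mul, PowerSeries.coeff_derivative, mul_comm]

theorem IsLogDeriv.mul {L₁ L₂ Λ₁ Λ₂ : PowerSeries ℂ} (h₁ : IsLogDeriv L₁ Λ₁)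
    (h₂ : IsLogDeriv L₂ Λ₂) : IsLogDeriv (L₁ * L₂) (Λ₁ + Λ₂) := by
  rw [isLogDeriv_iff] at *
  rw [Derivation.leibniz, smul_eq_mul, smul_eq_mul]
  linear_combination L₂ * h₁ + L₁ * h₂

theorem IsLogDeriv.of_mul {L₁ L₂ Λ Λ₁ : PowerSeries ℂ} (h : IsLogDeriv (L₁ * L₂) Λ)
    (h₁ : IsLogDeriv L₁ Λ₁) (h0 : L₁ ≠ 0) : IsLogDeriv L₂ (Λ - Λ₁) := by
  rw [isLogDeriv_iff] at *
  rw [Derivation.leibniz, smul_eq_mul, smul_eq_mul] at h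
  apply mul_left_cancel₀ h0
  linear_combination h - L₂ * h₁

theorem IsLogDeriv.unique {L Λ Λ' : PowerSeries ℂ} (h : IsLogDeriv L Λ) (h' : IsLogDeriv L Λ')
    (h0 : L ≠ 0) : Λ = Λ' := by
  rw [isLogDeriv_iff] at *
  exact mul_left_cancel₀ h0 (h.symm.trans h')

theorem IsLogDeriv.rescale {L Λ : PowerSeries ℂ} (h : IsLogDeriv L Λ) (z : ℂ) :
    IsLogDeriv (PowerSeries.rescale z L) (PowerSeries.rescale z Λ) := by
  intro n
  rw [← map_mul, PowerSeries.coeff_rescale, PowerSeries.coeff_rescale, ← h n]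
  ring

theorem IsLogDeriv.conj {L Λ : PowerSeries ℂ} (h : IsLogDeriv L Λ) :
    IsLogDeriv (PowerSeries.map (starRingEnd ℂ) L) (PowerSeries.map (starRingEnd ℂ) Λ) := by
  intro n
  rw [← map_mul, PowerSeries.coeff_map, PowerSeries.coeff_map, ← h n, map_mul, map_natCast]

/-- The series `∑ ρ ^ n X ^ n` without its constant term. -/
noncomputable def geomTail (ρ : ℂ) : PowerSeries ℂ :=
  PowerSeries.mk fun n => if n = 0 then 0 else ρ ^ n

theorem one_sub_mul_geomTail (ρ : ℂ) :
    (1 - PowerSeries.C ρ * PowerSeries.X) * geomTail ρ = PowerSeries.C ρ * PowerSeries.X := by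
  ext n
  rw [sub_mul, one_mul, mul_assoc, map_sub, PowerSeries.coeff_C_mul, PowerSeries.coeff_C_mul]
  rcases n with _ | _ | n
  · simp [geomTail]
  · simp [geomTail, PowerSeries.coeff_succ_X_mul, PowerSeries.coeff_one_X]
  · simp [geomTail, PowerSeries.coeff_succ_X_mul, PowerSeries.coeff_X, pow_succ]
    ring

theorem isLogDeriv_one_sub (ρ : ℂ) :
    IsLogDeriv (1 - PowerSeries.C ρ * PowerSeries.X) (-geomTail ρ) := by
  rw [isLogDeriv_iff, mul_neg, one_sub_mul_geomTail]
  simp [Derivation.leibniz]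
  ring

theorem isLogDeriv_prod (s : Multiset ℂ) :
    IsLogDeriv (s.map fun ρ => 1 - PowerSeries.C ρ * PowerSeries.X).prod
      (s.map fun ρ => -geomTail ρ).sum := by
  induction s using Multiset.induction with
  | empty => intro n; cases n <;> simp [PowerSeries.coeff_one]
  | cons ρ s ih => simpa using (isLogDeriv_one_sub ρ).mul ih

theorem one_sub_ne_zero (ρ : ℂ) : 1 - PowerSeries.C ρ * PowerSeries.X ≠ 0 := by
  intro h
  have := congrArg PowerSeries.constantCoeff h
  simp at this

/-- A polynomial with constant term one is a product of factors `1 - r⁻¹ X` over its roots. -/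
theorem coe_eq_prod_roots {p : ℂ[X]} (hp : p.coeff 0 = 1) :
    (p : PowerSeries ℂ) =
      (p.roots.map fun r => 1 - PowerSeries.C r⁻¹ * PowerSeries.X).prod := by
  have hp0 : p ≠ 0 := by rintro rfl; simp at hp
  have h1 : p = C p.leadingCoeff * (p.roots.map fun r => X - C r).prod :=
    (IsAlgClosed.splits p).eq_prod_roots
  have hr : ∀ r ∈ p.roots, X - C r = C (-r) * (1 - C r⁻¹ * X) := by
    intro r hr
    have : r ≠ 0 := by
      rintro rfl
      rw [mem_roots hp0, IsRoot, ← coeff_zero_eq_eval_zero, hp] at hr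
      exact one_ne_zero hr
    have h2 : C r * C r⁻¹ = (1 : ℂ[X]) := by rw [← C_mul, mul_inv_cancel₀ this, C_1]
    rw [C_neg]
    linear_combination -X * h2
  rw [Multiset.map_congr rfl hr, Multiset.prod_map_mul, ← mul_assoc] at h1
  have h2 : C p.leadingCoeff * (p.roots.map fun r => C (-r)).prod = 1 := by
    have h3 : (p.roots.map fun r => C (-r)).prod = C (p.roots.map fun r => -r).prod := by
      rw [map_multiset_prod, Multiset.map_map]; rfl
    rw [h3, ← C_mul] at h1 ⊢
    have h4 := congrArg (eval 0) h1
    rw [← coeff_zero_eq_eval_zero, hp, eval_mul, eval_C, eval_multiset_prod, Multiset.map_map] at h4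
    simp only [Function.comp_def, eval_sub, eval_one, eval_mul, eval_X, mul_zero, sub_zero,
      Multiset.map_const', Multiset.prod_replicate, one_pow, mul_one] at h4
    rw [← h4, C_1]
  rw [h2, one_mul] at h1
  conv_lhs => rw [h1]
  rw [← Polynomial.coeToPowerSeries.ringHom_apply, map_multiset_prod, Multiset.map_map]
  congr 1
  refine Multiset.map_congr rfl fun r _ => ?_
  simp

open scoped ComplexOrder in

/-- A series with constant term one and non-negative logarithmic derivative dominates it. -/
theorem IsLogDeriv.coeff_le {L Λ : PowerSeries ℂ} (h : IsLogDeriv L Λ) (h0 : L.coeff 0 = 1)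
    (hΛ : ∀ n, 0 ≤ Λ.coeff n) (n : ℕ) : Λ.coeff n ≤ n * L.coeff n := by
  have hL : ∀ n, 0 ≤ L.coeff n := by
    intro n
    induction n using Nat.strong_induction_on with
    | _ n ih =>
      rcases Nat.eq_zero_or_pos n with rfl | hn
      · rw [h0]; exact zero_le_one
      · have hΛ0 : Λ.coeff 0 = 0 := by
          have := h 0
          simpa [PowerSeries.coeff_mul, h0] using this.symm
        have key : 0 ≤ (n : ℂ) * L.coeff n := by
          rw [h n, PowerSeries.coeff_mul]
          refine Finset.sum_nonneg fun p hp => ?_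
          rw [Finset.HasAntidiagonal.mem_antidiagonal] at hp
          rcases Nat.eq_zero_or_pos p.2 with h2 | h2
          · rw [h2, hΛ0, mul_zero]
          · exact mul_nonneg (ih _ (by omega)) (hΛ _)
        have hn' : (0 : ℂ) < n := by exact_mod_cast hn
        exact le_of_mul_le_mul_left (by rwa [mul_zero]) hn'
  rw [h n, PowerSeries.coeff_mul]
  calc Λ.coeff n = L.coeff 0 * Λ.coeff n := by rw [h0, one_mul]
    _ ≤ _ := Finset.single_le_sum (f := fun p : ℕ × ℕ => L.coeff p.1 * Λ.coeff p.2)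
      (fun p _ => mul_nonneg (hL _) (hΛ _)) (a := (0, n)) (by simp)

open scoped ComplexOrder in

/-- A polynomial with constant term one whose logarithmic derivative has coefficients bounded by
`q ^ n`, strictly so infinitely often, does not vanish on the closed disc of radius `q⁻¹`. -/
theorem IsLogDeriv.eval_ne_zero {p : ℂ[X]} {Λ : PowerSeries ℂ} {q : ℝ} (hq : 0 < q)
    (h : IsLogDeriv p Λ) (h0 : p.coeff 0 = 1) (hΛ : ∀ n, ‖Λ.coeff n‖ ≤ q ^ n)
    (hlt : ∀ N, ∃ n ≥ N, ‖Λ.coeff n‖ < q ^ n) {z : ℂ} (hz : ‖z‖ ≤ 1) :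
    p.eval (z / q) ≠ 0 := by
  intro hp
  have hq' : (q : ℂ) ≠ 0 := by exact_mod_cast hq.ne'
  obtain ⟨H, hH⟩ : ∃ H : ℂ[X], p.comp (C z * X) = (1 - C (q : ℂ) * X) * H := by
    have : (X - C (q : ℂ)⁻¹) ∣ p.comp (C z * X) := by
      rw [dvd_iff_isRoot, IsRoot, eval_comp, eval_mul, eval_C, eval_X, ← div_eq_mul_inv, hp]
    obtain ⟨H, hH⟩ := this
    refine ⟨C (-(q : ℂ)⁻¹) * H, hH.trans ?_⟩
    have h2 : C (q : ℂ) * C (q : ℂ)⁻¹ = 1 := by rw [← C_mul, mul_inv_cancel₀ hq', C_1]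
    rw [C_neg]
    linear_combination -X * H * h2
  have hres : PowerSeries.rescale z (p : PowerSeries ℂ) =
      (1 - PowerSeries.C (q : ℂ) * PowerSeries.X) * (H : PowerSeries ℂ) := by
    have h1 : PowerSeries.rescale z (p : PowerSeries ℂ) = (p.comp (C z * X) : ℂ[X]) := by
      ext n
      rw [PowerSeries.coeff_rescale, Polynomial.coeff_coe, Polynomial.coeff_coe,
        comp_C_mul_X_coeff, mul_comm]
    rw [h1, hH]
    simp
  have hz0 : H.coeff 0 = 1 := by
    have := congrArg (coeff · 0) hH
    simpa [comp_C_mul_X_coeff, mul_coeff_zero, h0] using this.symm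
  set M := PowerSeries.rescale z Λ - -geomTail (q : ℂ) with hM
  have hHM : IsLogDeriv H M := by
    have := h.rescale z
    rw [hres] at this
    exact this.of_mul (isLogDeriv_one_sub _) (one_sub_ne_zero _)
  have hS := hHM.mul hHM.conj
  have hMn (n : ℕ) (hn : n ≠ 0) : M.coeff n = z ^ n * Λ.coeff n + (q : ℂ) ^ n := by
    simp [hM, geomTail, hn]
  have hbd (n : ℕ) : ‖z ^ n * Λ.coeff n‖ ≤ ‖Λ.coeff n‖ := by
    rw [norm_mul, norm_pow]
    exact mul_le_of_le_one_left (norm_nonneg _) (pow_le_one₀ (norm_nonneg _) hz)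
  have hcoeff (n : ℕ) : (M + PowerSeries.map (starRingEnd ℂ) M).coeff n =
      ((2 * (M.coeff n).re : ℝ) : ℂ) := by
    rw [map_add, PowerSeries.coeff_map, Complex.add_conj]
  have hre (n : ℕ) (hn : n ≠ 0) : (M.coeff n).re = (z ^ n * Λ.coeff n).re + q ^ n := by
    rw [hMn n hn, Complex.add_re, ← Complex.ofReal_pow, Complex.ofReal_re]
  have hM0 : M.coeff 0 = 0 := by
    have := hHM 0
    simpa [PowerSeries.coeff_mul, hz0] using this.symm
  have hnonneg (n : ℕ) : 0 ≤ (M + PowerSeries.map (starRingEnd ℂ) M).coeff n := by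
    rw [hcoeff]
    rcases eq_or_ne n 0 with rfl | hn
    · simp [hM0]
    · have h1 := (abs_le.mp (Complex.abs_re_le_norm (z ^ n * Λ.coeff n))).1
      have h2 := (hbd n).trans (hΛ n)
      have : 0 ≤ 2 * (M.coeff n).re := by rw [hre n hn]; linarith
      exact_mod_cast this
  obtain ⟨n, hn, hlt⟩ := hlt ((H * H.map (starRingEnd ℂ)).natDegree + 1)
  have hle := hS.coeff_le (by simp [hz0, PowerSeries.coeff_mul]) hnonneg n
  have hzero : (H * PowerSeries.map (starRingEnd ℂ) H : PowerSeries ℂ).coeff n = 0 := by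
    have : (H * PowerSeries.map (starRingEnd ℂ) H : PowerSeries ℂ) =
        (H * H.map (starRingEnd ℂ) : ℂ[X]) := by
      rw [Polynomial.coe_mul]
      congr 1
      ext k
      simp
    rw [this, Polynomial.coeff_coe, coeff_eq_zero_of_natDegree_lt (by omega)]
  rw [hzero, mul_zero, hcoeff, hre n (by omega)] at hle
  have hle' : 2 * ((z ^ n * Λ.coeff n).re + q ^ n) ≤ 0 := by exact_mod_cast hle
  have h1 := (abs_le.mp (Complex.abs_re_le_norm (z ^ n * Λ.coeff n))).1
  have h2 := hbd n
  linarith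

open Filter Topology in

theorem tendsto_coeff_sum_geomTail {q : ℝ} (hq : 0 < q) (s : Multiset ℂ)
    (hs : ∀ ρ ∈ s, ‖ρ‖ < q) :
    Tendsto (fun n => (s.map fun ρ => -geomTail ρ).sum.coeff n / (q : ℂ) ^ n) atTop (𝓝 0) := by
  induction s using Multiset.induction with
  | empty => simp
  | cons ρ s ih =>
    have h1 : Tendsto (fun n : ℕ => (ρ / q) ^ n) atTop (𝓝 0) := by
      apply tendsto_pow_atTop_nhds_zero_of_norm_lt_one
      rw [norm_div, Complex.norm_real, Real.norm_of_nonneg hq.le, div_lt_one hq]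
      exact hs ρ (Multiset.mem_cons_self _ _)
    have h2 := h1.neg.add (ih fun ρ hρ => hs ρ (Multiset.mem_cons_of_mem hρ))
    rw [neg_zero, add_zero] at h2
    refine h2.congr' ?_
    filter_upwards [eventually_ne_atTop 0] with n hn
    rw [Multiset.map_cons, Multiset.sum_cons, map_add, add_div, div_pow]
    simp [geomTail, hn, neg_div]

open Filter Topology in

theorem IsLogDeriv.tendsto_coeff_div {p : ℂ[X]} {Λ : PowerSeries ℂ} {q : ℝ} (hq : 0 < q)
    (h : IsLogDeriv p Λ) (h0 : p.coeff 0 = 1) (hΛ : ∀ n, ‖Λ.coeff n‖ ≤ q ^ n)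
    (hlt : ∀ N, ∃ n ≥ N, ‖Λ.coeff n‖ < q ^ n) :
    Tendsto (fun n => Λ.coeff n / (q : ℂ) ^ n) atTop (𝓝 0) := by
  have hp0 : p ≠ 0 := by rintro rfl; simp at h0
  have hprod := isLogDeriv_prod (p.roots.map (·⁻¹))
  rw [Multiset.map_map, Function.comp_def, ← coe_eq_prod_roots h0] at hprod
  rw [h.unique hprod (by rwa [Ne, Polynomial.coe_eq_zero_iff])]
  refine tendsto_coeff_sum_geomTail hq _ fun ρ hρ => ?_
  obtain ⟨r, hr, rfl⟩ := Multiset.mem_map.mp hρ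
  by_contra! hle
  refine h.eval_ne_zero hq h0 hΛ hlt (z := r * q) ?_ ?_
  · rw [norm_inv] at hle
    rw [norm_mul, Complex.norm_real, Real.norm_of_nonneg hq.le]
    rcases (norm_nonneg r).eq_or_lt with hr0 | hr0
    · rw [← hr0, zero_mul]; exact zero_le_one
    · calc ‖r‖ * q ≤ ‖r‖ * ‖r‖⁻¹ := by gcongr
        _ = 1 := mul_inv_cancel₀ hr0.ne'
  · rw [mul_div_cancel_right₀ _ (by exact_mod_cast hq.ne')]
    exact (mem_roots hp0).mp hr

end LogDeriv

section Characters
open Filter Topology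
variable {F : Type*} [Field F] [Finite F]

/-- The residue ring of a nonzero polynomial over a finite field is finite. -/
theorem finite_adjoinRoot {a : F[X]} (ha : a ≠ 0) : Finite (AdjoinRoot a) :=
  have := (AdjoinRoot.powerBasis ha).finite
  Module.finite_of_finite F

theorem lSeries_one : lSeries (1 : F[X] →* ℂ) = PowerSeries.mk fun n => (Nat.card F : ℂ) ^ n := by
  ext n
  simp [lSeries, card_monics]

theorem primeSeries_one : primeSeries (1 : F[X] →* ℂ) = geomTail (Nat.card F) := by
  have hone : (1 - PowerSeries.C (Nat.card F : ℂ) * PowerSeries.X) * lSeries (1 : F[X] →* ℂ) =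
      1 := by
    ext n
    rw [lSeries_one, sub_mul, one_mul, mul_assoc, map_sub, PowerSeries.coeff_C_mul]
    cases n with
    | zero => simp
    | succ n => simp [PowerSeries.coeff_succ_X_mul, PowerSeries.coeff_one, pow_succ, mul_comm]
  have hlog : IsLogDeriv (1 : PowerSeries ℂ) 0 := by
    intro n
    cases n <;> simp [PowerSeries.coeff_one]
  rw [← hone] at hlog
  have := (isLogDeriv_lSeries (1 : F[X] →* ℂ)).unique
    (hlog.of_mul (isLogDeriv_one_sub _) (one_sub_ne_zero _)) (right_ne_zero_of_mul_eq_one hone)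
  rw [this, zero_sub, neg_neg]

/-- The prime polynomial theorem in its exact form. -/
theorem sum_natDegree_primePowers {n : ℕ} (hn : n ≠ 0) :
    ∑ x ∈ primePowers F n, x.1.natDegree = Nat.card F ^ n := by
  have := congrArg (PowerSeries.coeff n) (primeSeries_one (F := F))
  simp only [primeSeries, geomTail, PowerSeries.coeff_mk, MonoidHom.one_apply, mul_one, if_neg hn]
    at this
  exact_mod_cast this

theorem sum_natDegree_primePowers_le (n : ℕ) :
    ∑ x ∈ primePowers F n, x.1.natDegree ≤ Nat.card F ^ n := by
  rcases eq_or_ne n 0 with rfl | hn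
  · rw [Finset.sum_eq_zero]
    · exact Nat.zero_le _
    · intro x hx
      rw [mem_primePowers] at hx
      exact (mul_eq_zero.mp hx.2.2.2).resolve_left hx.2.2.1
  · exact (sum_natDegree_primePowers hn).le

theorem norm_coeff_primeSeries_le {χ : F[X] →* ℂ} (hχ : ∀ f, ‖χ f‖ ≤ 1) (n : ℕ) :
    ‖(primeSeries χ).coeff n‖ ≤ (Nat.card F : ℝ) ^ n := by
  rw [primeSeries, PowerSeries.coeff_mk]
  have hle : ∑ x ∈ primePowers F n, (x.1.natDegree : ℝ) ≤ (Nat.card F : ℝ) ^ n := by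
    exact_mod_cast sum_natDegree_primePowers_le n
  refine (norm_sum_le _ _).trans ((Finset.sum_le_sum fun x _ => ?_).trans hle)
  rw [norm_mul, Complex.norm_natCast]
  exact mul_le_of_le_one_right (Nat.cast_nonneg _) (hχ _)

theorem norm_coeff_primeSeries_lt {χ : F[X] →* ℂ} (hχ : ∀ f, ‖χ f‖ ≤ 1) {P : F[X]}
    (hm : P.Monic) (hP : Irreducible P) (h0 : χ P = 0) (N : ℕ) :
    ∃ n ≥ N, ‖(primeSeries χ).coeff n‖ < (Nat.card F : ℝ) ^ n := by
  refine ⟨(N + 1) * P.natDegree, ?_, ?_⟩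
  · exact (Nat.le_succ N).trans (Nat.le_mul_of_pos_right _ hP.natDegree_pos)
  rw [primeSeries, PowerSeries.coeff_mk]
  have hle : ∑ x ∈ primePowers F ((N + 1) * P.natDegree), (x.1.natDegree : ℝ) ≤
      (Nat.card F : ℝ) ^ ((N + 1) * P.natDegree) := by
    exact_mod_cast sum_natDegree_primePowers_le _
  refine (norm_sum_le _ _).trans_lt ((Finset.sum_lt_sum (fun x _ => ?_)
    ⟨(P, N + 1), mem_primePowers.mpr ⟨hm, hP, N.succ_ne_zero, rfl⟩, ?_⟩).trans_le hle)
  · rw [norm_mul, Complex.norm_natCast]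
    exact mul_le_of_le_one_right (Nat.cast_nonneg _) (hχ _)
  · simpa [h0] using hP.natDegree_pos

/-- Prime powers whose base has bounded degree contribute little. -/
theorem sum_natDegree_le_of_subset {n d : ℕ} {s : Finset (F[X] × ℕ)} (hs : s ⊆ primePowers F n)
    (hd : ∀ x ∈ s, x.1.natDegree ≤ d) :
    ∑ x ∈ s, x.1.natDegree ≤ Nat.card F ^ (d + 1) * d := by
  refine (Finset.sum_le_card_nsmul s _ d hd).trans ?_
  rw [smul_eq_mul]
  gcongr
  rw [← ncard_degreeLT, ← Set.ncard_coe_finset]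
  refine Set.ncard_le_ncard_of_injOn Prod.fst (fun x hx => ?_) ?_ (finite_degreeLT F (d + 1))
  · have := (mem_primePowers.mp (hs hx)).2.1
    rw [SetLike.mem_coe, mem_degreeLT, degree_eq_natDegree this.ne_zero]
    exact_mod_cast Nat.lt_succ_of_le (hd x hx)
  · rintro ⟨P, k⟩ hx ⟨P', k'⟩ hx' rfl
    have h1 := mem_primePowers.mp (hs hx)
    have h2 := mem_primePowers.mp (hs hx')
    have := Nat.eq_of_mul_eq_mul_right h1.2.1.natDegree_pos (h1.2.2.2.trans h2.2.2.2.symm)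
    rw [Prod.mk.injEq]
    exact ⟨rfl, this⟩

variable {m : F[X]}

/-- The completely multiplicative function on polynomials attached to a character modulo `m`. -/
noncomputable def charHom (χ : MulChar (AdjoinRoot m) ℂ) : F[X] →* ℂ :=
  χ.toMonoidHom.comp (AdjoinRoot.mk m : F[X] →* AdjoinRoot m)

theorem charHom_apply {F : Type*} [Field F] {m : F[X]} (χ : MulChar (AdjoinRoot m) ℂ) (f : F[X]) :
    charHom χ f = χ (AdjoinRoot.mk m f) := rfl

theorem norm_mulChar_le_one {M : Type*} [CommMonoid M] [Finite M] (χ : MulChar M ℂ) (x : M) :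
    ‖χ x‖ ≤ 1 := by
  by_cases hx : IsUnit x
  · obtain ⟨u, rfl⟩ := hx
    refine ((pow_eq_one_iff_of_nonneg (norm_nonneg _) (Nat.card_pos (α := Mˣ)).ne').mp ?_).le
    rw [← norm_pow, ← map_pow, ← Units.val_pow_eq_pow_val, pow_card_eq_one', Units.val_one,
      map_one, norm_one]
  · rw [χ.map_nonunit hx, norm_zero]
    exact zero_le_one

theorem not_isUnit_mk {F : Type*} [Field F] {m P : F[X]} (hP : Irreducible P) (h : P ∣ m) :
    ¬ IsUnit (AdjoinRoot.mk m P) := by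
  intro hu
  obtain ⟨y, hy⟩ := hu.exists_right_inv
  obtain ⟨f, rfl⟩ := AdjoinRoot.mk_surjective y
  rw [← map_mul, ← map_one (AdjoinRoot.mk m), AdjoinRoot.mk_eq_mk] at hy
  have h1 : P ∣ P * f - 1 := h.trans hy
  exact hP.not_isUnit (isUnit_of_dvd_one ((dvd_sub_right (dvd_mul_right P f)).mp h1))

theorem isUnit_mk {F : Type*} [Field F] {m P : F[X]} (h : IsCoprime P m) :
    IsUnit (AdjoinRoot.mk m P) := by
  obtain ⟨x, y, hxy⟩ := h
  refine IsUnit.of_mul_eq_one (AdjoinRoot.mk m x) ?_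
  rw [← map_mul, ← map_one (AdjoinRoot.mk m), AdjoinRoot.mk_eq_mk]
  exact ⟨-y, by linear_combination hxy⟩

/-- Sums of a nontrivial character over monic polynomials of large degree vanish. -/
theorem sum_monics_charHom_eq_zero (hm : m ≠ 0) {χ : MulChar (AdjoinRoot m) ℂ} (hχ : χ ≠ 1)
    {n : ℕ} (hn : m.natDegree ≤ n) : ∑ f ∈ monics F n, charHom χ f = 0 := by
  classical
  have := finite_adjoinRoot hm
  have := Fintype.ofFinite (AdjoinRoot m)
  have hcard (x : AdjoinRoot m) : ((monics F n).filter (AdjoinRoot.mk m · = x)).card =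
      ((monics F n).filter (AdjoinRoot.mk m · = 0)).card := by
    obtain ⟨g, rfl⟩ := AdjoinRoot.mk_surjective x
    have hg : (g % m).degree < m.natDegree := by
      rw [← degree_eq_natDegree hm]; exact degree_mod_lt g hm
    have hmk : AdjoinRoot.mk m (g % m) = AdjoinRoot.mk m g := by
      rw [AdjoinRoot.mk_eq_mk, ← neg_sub, dvd_neg]
      exact ⟨g / m, by linear_combination -EuclideanDomain.div_add_mod g m⟩
    have hadd {f r : F[X]} (hr : r.degree < m.natDegree) (hf : f ∈ monics F n) :
        f + r ∈ monics F n := by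
      rw [mem_monics] at hf ⊢
      have : r.degree < f.degree := by
        rw [degree_eq_natDegree hf.1.ne_zero, hf.2]
        exact hr.trans_le (by exact_mod_cast hn)
      exact ⟨hf.1.add_of_left this, (natDegree_add_eq_left_of_degree_lt this).trans hf.2⟩
    refine Finset.card_nbij' (· - g % m) (· + g % m) ?_ ?_ ?_ ?_
    · intro f hf
      simp only [Finset.coe_filter, Set.mem_ofPred_eq] at hf ⊢
      refine ⟨?_, by rw [map_sub, hf.2, hmk, sub_self]⟩
      rw [sub_eq_add_neg]
      exact hadd (by rwa [degree_neg]) hf.1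
    · intro f hf
      simp only [Finset.coe_filter, Set.mem_ofPred_eq] at hf ⊢
      exact ⟨hadd hg hf.1, by rw [map_add, hf.2, hmk, zero_add]⟩
    · intro f _; simp
    · intro f _; simp
  simp only [charHom_apply]
  rw [← Finset.sum_fiberwise (monics F n) (AdjoinRoot.mk m)]
  have h2 (x : AdjoinRoot m) : ∑ f ∈ monics F n with AdjoinRoot.mk m f = x, χ (AdjoinRoot.mk m f) =
      ((monics F n).filter (AdjoinRoot.mk m · = 0)).card * χ x := by
    rw [← hcard x, ← nsmul_eq_mul, ← Finset.sum_const]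
    exact Finset.sum_congr rfl fun f hf => by rw [(Finset.mem_filter.mp hf).2]
  simp only [h2]
  rw [← Finset.mul_sum, MulChar.sum_eq_zero_of_ne_one hχ, mul_zero]

theorem card_cast_pos : 0 < (Nat.card F : ℝ) := by
  exact_mod_cast Nat.card_pos (α := F)

/-- The prime sum of a nontrivial character is negligible. -/
theorem tendsto_primeSeries_of_ne_one (hm : m ≠ 0) {χ : MulChar (AdjoinRoot m) ℂ} (hχ : χ ≠ 1) :
    Tendsto (fun n => (primeSeries (charHom χ)).coeff n / (Nat.card F : ℂ) ^ n) atTop (𝓝 0) := by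
  classical
  have := finite_adjoinRoot hm
  have hbd (f : F[X]) : ‖charHom χ f‖ ≤ 1 := norm_mulChar_le_one χ _
  have hpoly : ((lSeries (charHom χ)).trunc m.natDegree : PowerSeries ℂ) = lSeries (charHom χ) := by
    ext n
    rw [Polynomial.coeff_coe, PowerSeries.coeff_trunc]
    split_ifs with h
    · rfl
    · rw [lSeries, PowerSeries.coeff_mk, sum_monics_charHom_eq_zero hm hχ (not_lt.mp h)]
  have hunit : ¬ IsUnit m := by
    intro hu
    have : Subsingleton (AdjoinRoot m) := by
      refine subsingleton_of_zero_eq_one ?_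
      rw [← map_zero (AdjoinRoot.mk m), ← map_one (AdjoinRoot.mk m), AdjoinRoot.mk_eq_mk]
      exact hu.dvd
    refine hχ (MulChar.ext fun u => ?_)
    rw [Subsingleton.elim (u : AdjoinRoot m) 1, map_one, map_one]
  obtain ⟨P, hP, hPm⟩ := WfDvdMonoid.exists_irreducible_factor hunit hm
  have hass := associated_normalize P
  have hP' := hass.irreducible hP
  have hlog := isLogDeriv_lSeries (charHom χ)
  rw [← hpoly] at hlog
  have := hlog.tendsto_coeff_div card_cast_pos ?_ (norm_coeff_primeSeries_le hbd)
    (norm_coeff_primeSeries_lt hbd (monic_normalize hP.ne_zero) hP'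
      (χ.map_nonunit (not_isUnit_mk hP' (hass.symm.dvd.trans hPm))))
  · simpa using this
  · rw [← Polynomial.coeff_coe, hpoly, lSeries, PowerSeries.coeff_mk, Finset.sum_eq_single 1]
    · exact map_one _
    · intro f hf hf1
      rw [mem_monics] at hf
      exact absurd (hf.1.natDegree_eq_zero.mp hf.2) hf1
    · intro h
      exact absurd (mem_monics.mpr ⟨monic_one, natDegree_one⟩) h

/-- The prime sum of the trivial character has the expected size. -/
theorem tendsto_primeSeries_one (hm : m ≠ 0) :
    Tendsto (fun n => (primeSeries (charHom (1 : MulChar (AdjoinRoot m) ℂ))).coeff n /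
      (Nat.card F : ℂ) ^ n) atTop (𝓝 1) := by
  classical
  have hq0 : (Nat.card F : ℂ) ≠ 0 := by exact_mod_cast (Nat.card_pos (α := F)).ne'
  have hq1 : 1 < (Nat.card F : ℝ) := by exact_mod_cast Finite.one_lt_card (α := F)
  set B : ℝ := ((Nat.card F ^ (m.natDegree + 1) * m.natDegree : ℕ) : ℝ) with hB
  rw [tendsto_iff_norm_sub_tendsto_zero]
  have hlim : Tendsto (fun n : ℕ => B * ((Nat.card F : ℝ)⁻¹) ^ n) atTop (𝓝 0) := by
    rw [← mul_zero B]
    exact (tendsto_pow_atTop_nhds_zero_of_lt_one (by positivity)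
      (inv_lt_one_of_one_lt₀ hq1)).const_mul B
  refine squeeze_zero' (Eventually.of_forall fun n => norm_nonneg _) ?_ hlim
  filter_upwards [eventually_ne_atTop 0] with n hn
  have hkey : (primeSeries (charHom (1 : MulChar (AdjoinRoot m) ℂ))).coeff n -
      (Nat.card F : ℂ) ^ n = -∑ x ∈ primePowers F n with x.1 ∣ m, (x.1.natDegree : ℂ) := by
    have h1 : ((Nat.card F : ℂ) ^ n) = ∑ x ∈ primePowers F n, (x.1.natDegree : ℂ) := by
      exact_mod_cast (sum_natDegree_primePowers hn).symm
    rw [h1, primeSeries, PowerSeries.coeff_mk, ← Finset.sum_sub_distrib, Finset.sum_filter,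
      ← Finset.sum_neg_distrib]
    refine Finset.sum_congr rfl fun x hx => ?_
    rw [mem_primePowers] at hx
    rw [map_pow, charHom_apply]
    split_ifs with hd
    · rw [MulChar.map_nonunit _ (not_isUnit_mk hx.2.1 hd), zero_pow hx.2.2.1]
      ring
    · rw [MulChar.one_apply (isUnit_mk ((hx.2.1.coprime_iff_not_dvd).mpr hd)), one_pow]
      ring
  have hdiv : (primeSeries (charHom (1 : MulChar (AdjoinRoot m) ℂ))).coeff n /
      (Nat.card F : ℂ) ^ n - 1 =
      (-∑ x ∈ primePowers F n with x.1 ∣ m, (x.1.natDegree : ℂ)) / (Nat.card F : ℂ) ^ n := by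
    rw [← hkey, sub_div, div_self (pow_ne_zero n hq0)]
  rw [hdiv, norm_div, norm_neg, norm_pow, Complex.norm_natCast, inv_pow, ← div_eq_mul_inv]
  gcongr
  rw [← Nat.cast_sum, Complex.norm_natCast, hB]
  exact_mod_cast sum_natDegree_le_of_subset (Finset.filter_subset _ _) fun x hx =>
    natDegree_le_of_dvd (Finset.mem_filter.mp hx).2 hm

/-- **Dirichlet's theorem** for polynomials over a finite field: a coprime residue class contains
irreducible polynomials of every sufficiently large degree. -/
theorem exists_irreducible_dvd_sub {a : F[X]} (hm : m ≠ 0)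
    (h : IsCoprime a m) : ∃ N, ∀ n ≥ N, ∃ P, Irreducible P ∧ P.natDegree = n ∧ m ∣ P - a := by
  classical
  have := finite_adjoinRoot hm
  have := Fintype.ofFinite (MulChar (AdjoinRoot m) ℂ)
  obtain ⟨b, hb⟩ := (isUnit_mk h).exists_right_inv
  have hq1 : 1 < (Nat.card F : ℝ) := by exact_mod_cast Finite.one_lt_card (α := F)
  have hsum : Tendsto (fun n => ∑ χ : MulChar (AdjoinRoot m) ℂ,
      χ b * ((primeSeries (charHom χ)).coeff n / (Nat.card F : ℂ) ^ n)) atTop (𝓝 1) := by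
    have hlim (χ : MulChar (AdjoinRoot m) ℂ) : Tendsto
        (fun n => χ b * ((primeSeries (charHom χ)).coeff n / (Nat.card F : ℂ) ^ n)) atTop
        (𝓝 (if χ = 1 then 1 else 0)) := by
      split_ifs with hχ
      · subst hχ
        have hub : IsUnit b := IsUnit.of_mul_eq_one (AdjoinRoot.mk m a) (by rw [mul_comm, hb])
        simpa [MulChar.one_apply hub] using tendsto_primeSeries_one hm
      · simpa using (tendsto_primeSeries_of_ne_one hm hχ).const_mul (χ b)
    simpa using tendsto_finsetSum Finset.univ fun χ _ => hlim χ
  have hsmall : Tendsto (fun n : ℕ => (Fintype.card (MulChar (AdjoinRoot m) ℂ) * Nat.card F : ℝ) *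
      (n * (√(Nat.card F))⁻¹ ^ n)) atTop (𝓝 0) := by
    rw [← mul_zero (Fintype.card (MulChar (AdjoinRoot m) ℂ) * Nat.card F : ℝ)]
    refine (tendsto_self_mul_const_pow_of_lt_one (by positivity)
      (inv_lt_one_of_one_lt₀ ?_)).const_mul _
    rwa [Real.lt_sqrt zero_le_one, one_pow]
  have hev := (hsum.norm.eventually_const_lt (u := 1 / 2) (by norm_num)).and
    (hsmall.eventually_lt_const (u := 1 / 2) (by norm_num))
  obtain ⟨N, hN⟩ := eventually_atTop.mp hev
  refine ⟨N, fun n hn => ?_⟩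
  by_contra! hcon
  obtain ⟨h1, h2⟩ := hN n hn
  refine absurd (h1.trans_le (le_trans ?_ h2.le)) (lt_irrefl _)
  have horth (x : AdjoinRoot m) (hx : x ≠ AdjoinRoot.mk m a) :
      ∑ χ : MulChar (AdjoinRoot m) ℂ, χ b * χ x = 0 := by
    have hx1 : b * x ≠ 1 := fun h => hx (by
      linear_combination (AdjoinRoot.mk m a) * h - x * hb)
    obtain ⟨χ, hχ⟩ := MulChar.exists_apply_ne_one_of_hasEnoughRootsOfUnity (AdjoinRoot m) ℂ hx1
    simp only [← map_mul]
    refine eq_zero_of_mul_eq_self_left hχ ?_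
    simp only [Finset.mul_sum, ← MulChar.mul_apply]
    exact Fintype.sum_bijective _ (Group.mulLeft_bijective χ) _ _ fun χ' => rfl
  set s := (primePowers F n).filter fun x => x.2 ≠ 1 with hs
  have hrw : ∑ χ : MulChar (AdjoinRoot m) ℂ,
      χ b * ((primeSeries (charHom χ)).coeff n / (Nat.card F : ℂ) ^ n) =
      (∑ x ∈ s, x.1.natDegree * ∑ χ : MulChar (AdjoinRoot m) ℂ,
        χ b * χ (AdjoinRoot.mk m (x.1 ^ x.2))) / (Nat.card F : ℂ) ^ n := by
    have hfilter : ∑ x ∈ s, x.1.natDegree * ∑ χ : MulChar (AdjoinRoot m) ℂ,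
        χ b * χ (AdjoinRoot.mk m (x.1 ^ x.2)) =
        ∑ x ∈ primePowers F n, x.1.natDegree * ∑ χ : MulChar (AdjoinRoot m) ℂ,
        χ b * χ (AdjoinRoot.mk m (x.1 ^ x.2)) := by
      refine Finset.sum_subset (Finset.filter_subset _ _) fun x hx hxs => ?_
      have hx2 : x.2 = 1 := by
        by_contra hne
        exact hxs (Finset.mem_filter.mpr ⟨hx, hne⟩)
      rw [mem_primePowers, hx2, one_mul] at hx
      rw [hx2, pow_one, horth, mul_zero]
      rw [Ne, AdjoinRoot.mk_eq_mk]
      exact hcon x.1 hx.2.1 hx.2.2.2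
    rw [hfilter, Finset.sum_div]
    simp only [Finset.mul_sum, Finset.sum_div]
    rw [Finset.sum_comm]
    refine Finset.sum_congr rfl fun χ _ => ?_
    rw [primeSeries, PowerSeries.coeff_mk, Finset.sum_div, Finset.mul_sum]
    refine Finset.sum_congr rfl fun x _ => ?_
    rw [charHom_apply]
    ring
  have hbound : ∑ x ∈ s, x.1.natDegree ≤ Nat.card F ^ (n / 2 + 1) * (n / 2) := by
    refine sum_natDegree_le_of_subset (Finset.filter_subset _ _) fun x hx => ?_
    rw [hs, Finset.mem_filter,
      mem_primePowers] at hx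
    rw [Nat.le_div_iff_mul_le two_pos, ← hx.1.2.2.2, mul_comm]
    have := hx.1.2.2.1
    have := hx.2
    gcongr
    omega
  set c : ℝ := (Fintype.card (MulChar (AdjoinRoot m) ℂ) : ℝ) with hc
  rw [hrw, norm_div, norm_pow, Complex.norm_natCast]
  have hnum : ‖∑ x ∈ s, x.1.natDegree * ∑ χ : MulChar (AdjoinRoot m) ℂ,
        χ b * χ (AdjoinRoot.mk m (x.1 ^ x.2))‖ ≤ (Nat.card F ^ (n / 2 + 1) * (n / 2 : ℕ)) * c := by
    calc _ ≤ ∑ x ∈ s, (x.1.natDegree : ℝ) * c := by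
          refine norm_sum_le_of_le _ fun x _ => ?_
          rw [norm_mul, Complex.norm_natCast]
          gcongr
          refine (norm_sum_le_of_le (n := fun _ => (1 : ℝ)) _ fun χ _ => ?_).trans (by simp [hc])
          rw [← map_mul]
          exact norm_mulChar_le_one χ _
      _ ≤ _ := by
          rw [← Finset.sum_mul]
          gcongr
          exact_mod_cast hbound
  rw [div_le_iff₀ (by positivity)]
  refine hnum.trans ?_
  have hs0 : 0 < √(Nat.card F : ℝ) := Real.sqrt_pos.mpr card_cast_pos
  have hsq : √(Nat.card F : ℝ) ^ 2 = Nat.card F := Real.sq_sqrt card_cast_pos.le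
  have hhalf : (Nat.card F : ℝ) ^ (n / 2) ≤ √(Nat.card F : ℝ) ^ n := by
    rw [← hsq, ← pow_mul, Real.sqrt_sq hs0.le]
    exact pow_le_pow_right₀ (by rw [Real.one_le_sqrt]; exact hq1.le) (Nat.mul_div_le n 2)
  have hinv : (√(Nat.card F : ℝ))⁻¹ ^ n * (Nat.card F : ℝ) ^ n = √(Nat.card F : ℝ) ^ n := by
    rw [← mul_pow]
    nth_rw 2 [← hsq]
    rw [sq, inv_mul_cancel_left₀ hs0.ne']
  have hn2 : ((n / 2 : ℕ) : ℝ) ≤ n := by exact_mod_cast Nat.div_le_self n 2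
  calc (Nat.card F : ℝ) ^ (n / 2 + 1) * (n / 2 : ℕ) * c
      = c * Nat.card F * ((n / 2 : ℕ) * (Nat.card F : ℝ) ^ (n / 2)) := by ring
    _ ≤ c * Nat.card F * (n * √(Nat.card F : ℝ) ^ n) := by gcongr
    _ = _ := by rw [← hinv]; ring
end Characters

open Matrix

section Families
variable {R : Type*} [CommRing R]

/-- `S` is contained in the image of a polynomial family in `SL₂` with `n` parameters. -/
def Covered (n : ℕ) (S : Set SL(2, R)) : Prop :=
  ∃ g : SL(2, MvPolynomial (Fin n) R), ∀ α ∈ S, ∃ v : Fin n → R,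
    SpecialLinearGroup.map (MvPolynomial.eval v) g = α

theorem Covered.mono {n : ℕ} {S T : Set SL(2, R)} (hT : Covered n T) (h : S ⊆ T) :
    Covered n S :=
  hT.imp fun _ hg α hα => hg α (h hα)

theorem Covered.mul {m n : ℕ} {S T : Set SL(2, R)} (hS : Covered m S) (hT : Covered n T) :
    Covered (m + n) (S * T) := by
  obtain ⟨g, hg⟩ := hS
  obtain ⟨h, hh⟩ := hT
  refine ⟨SpecialLinearGroup.map (MvPolynomial.rename (Fin.castAdd n)).toRingHom g *
    SpecialLinearGroup.map (MvPolynomial.rename (Fin.natAdd m)).toRingHom h, ?_⟩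
  rintro _ ⟨α, hα, β, hβ, rfl⟩
  obtain ⟨v, rfl⟩ := hg α hα
  obtain ⟨w, rfl⟩ := hh β hβ
  refine ⟨Fin.append v w, ?_⟩
  rw [map_mul]
  congr 1 <;> ext i j <;>
    simp [SpecialLinearGroup.map_apply_coe, MvPolynomial.eval_rename, Function.comp_def]

theorem Covered.inv {n : ℕ} {S : Set SL(2, R)} (hS : Covered n S) : Covered n S⁻¹ := by
  obtain ⟨g, hg⟩ := hS
  refine ⟨g⁻¹, fun α hα => ?_⟩
  obtain ⟨v, hv⟩ := hg _ hα
  exact ⟨v, by rw [map_inv, hv, inv_inv]⟩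

theorem Covered.transpose {n : ℕ} {S : Set SL(2, R)} (hS : Covered n S) :
    Covered n {α | α.transpose ∈ S} := by
  obtain ⟨g, hg⟩ := hS
  refine ⟨g.transpose, fun α hα => ?_⟩
  obtain ⟨v, hv⟩ := hg _ hα
  refine ⟨v, ?_⟩
  ext i j
  have := congrArg (fun β : SL(2, R) => β j i) hv
  simpa [SpecialLinearGroup.map_apply_coe] using this

theorem Covered.of_le {m n : ℕ} {S : Set SL(2, R)} (hS : Covered m S) (h : m ≤ n) :
    Covered n S := by
  obtain ⟨k, rfl⟩ := Nat.exists_eq_add_of_le h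
  have h1 : Covered k ({1} : Set SL(2, R)) := ⟨1, by rintro _ rfl; exact ⟨0, map_one _⟩⟩
  simpa using hS.mul h1

/-- The elementary matrix with off-diagonal entry `x` above the diagonal. -/
def upper (x : R) : SL(2, R) := ⟨!![1, x; 0, 1], by simp⟩

/-- The elementary matrix with off-diagonal entry `x` below the diagonal. -/
def lower (x : R) : SL(2, R) := ⟨!![1, 0; x, 1], by simp⟩

/-- The standard Weyl element. -/
def weyl : SL(2, R) := ⟨!![0, 1; -1, 0], by simp⟩

/-- The value at `(s, q, 1 + s * t)` of the polynomial matrix obtained from the commutator of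
`lower s⁻¹` with a matrix whose second column is `(s ^ 2 * q, 1 + s * t)`. -/
def scaling (s q t : R) : SL(2, R) :=
  ⟨!![1 - s * q * (1 + s * t), s ^ 3 * q ^ 2;
      -q * (1 + s * t) - 2 * t - s * t ^ 2, 1 + s * q * (1 + s * t) + s ^ 2 * q ^ 2], by
    rw [det_fin_two_of]; ring⟩

variable (R) in

/-- The set of upper unitriangular matrices. -/
def U : Set SL(2, R) := Set.range upper

variable (R) in

/-- The set of lower unitriangular matrices. -/
def L : Set SL(2, R) := Set.range lower

variable (R) in

/-- The three-parameter set of matrices used to move a square factor across the diagonal. -/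
def Q : Set SL(2, R) := {α | ∃ s q t, α = upper s * (scaling s q t)⁻¹ * upper s}

theorem coe_upper (x : R) : (upper x : Matrix (Fin 2) (Fin 2) R) = !![1, x; 0, 1] := rfl

theorem coe_lower (x : R) : (lower x : Matrix (Fin 2) (Fin 2) R) = !![1, 0; x, 1] := rfl

theorem coe_weyl : ((weyl : SL(2, R)) : Matrix (Fin 2) (Fin 2) R) = !![0, 1; -1, 0] := rfl

theorem coe_scaling (s q t : R) : (scaling s q t : Matrix (Fin 2) (Fin 2) R) =
    !![1 - s * q * (1 + s * t), s ^ 3 * q ^ 2;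
      -q * (1 + s * t) - 2 * t - s * t ^ 2, 1 + s * q * (1 + s * t) + s ^ 2 * q ^ 2] := rfl

theorem map_upper {S : Type*} [CommRing S] (f : R →+* S) (x : R) :
    SpecialLinearGroup.map f (upper x) = upper (f x) := by
  ext i j
  fin_cases i <;> fin_cases j <;> simp [coe_upper]

theorem map_lower {S : Type*} [CommRing S] (f : R →+* S) (x : R) :
    SpecialLinearGroup.map f (lower x) = lower (f x) := by
  ext i j
  fin_cases i <;> fin_cases j <;> simp [coe_lower]

theorem map_scaling {S : Type*} [CommRing S] (f : R →+* S) (s q t : R) :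
    SpecialLinearGroup.map f (scaling s q t) = scaling (f s) (f q) (f t) := by
  ext i j
  fin_cases i <;> fin_cases j <;> simp [coe_scaling, map_ofNat]

theorem covered_U : Covered 1 (U R) := by
  refine ⟨upper (MvPolynomial.X 0), ?_⟩
  rintro _ ⟨x, rfl⟩
  exact ⟨fun _ => x, by simp [map_upper]⟩

theorem covered_L : Covered 1 (L R) := by
  refine ⟨lower (MvPolynomial.X 0), ?_⟩
  rintro _ ⟨x, rfl⟩
  exact ⟨fun _ => x, by simp [map_lower]⟩

theorem covered_Q : Covered 3 (Q R) := by
  refine ⟨upper (MvPolynomial.X 0) *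
    (scaling (MvPolynomial.X 0) (MvPolynomial.X 1) (MvPolynomial.X 2))⁻¹ *
    upper (MvPolynomial.X 0), ?_⟩
  rintro _ ⟨s, q, t, rfl⟩
  exact ⟨![s, q, t], by simp [map_upper, map_scaling]⟩

theorem upper_mem_U (x : R) : upper x ∈ U R := ⟨x, rfl⟩

theorem lower_mem_L (x : R) : lower x ∈ L R := ⟨x, rfl⟩

theorem upper_mul_upper (x y : R) : upper x * upper y = upper (x + y) := by
  ext i j
  fin_cases i <;> fin_cases j <;> simp [coe_upper, add_comm]

theorem upper_inv (x : R) : (upper x)⁻¹ = upper (-x) := by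
  ext i j
  fin_cases i <;> fin_cases j <;> simp [coe_upper, adjugate_fin_two]

theorem lower_inv (x : R) : (lower x)⁻¹ = lower (-x) := by
  ext i j
  fin_cases i <;> fin_cases j <;> simp [coe_lower, adjugate_fin_two]

theorem weyl_conj_lower (x : R) : weyl⁻¹ * lower x * weyl = upper (-x) := by
  ext i j
  fin_cases i <;> fin_cases j <;>
    simp [coe_lower, coe_upper, coe_weyl, adjugate_fin_two]

theorem weyl_conj_upper (x : R) : weyl⁻¹ * upper x * weyl = lower (-x) := by
  ext i j
  fin_cases i <;> fin_cases j <;>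
    simp [coe_lower, coe_upper, coe_weyl, adjugate_fin_two]

theorem det_eq (α : SL(2, R)) : α 0 0 * α 1 1 - α 0 1 * α 1 0 = 1 := by
  rw [← det_fin_two, α.det_coe]

theorem mul_entry (α β : SL(2, R)) (i j : Fin 2) :
    (α * β) i j = α i 0 * β 0 j + α i 1 * β 1 j := by
  simp [mul_apply, Fin.sum_univ_two]

theorem inv_entries (α : SL(2, R)) :
    α⁻¹ 0 0 = α 1 1 ∧ α⁻¹ 0 1 = -α 0 1 ∧ α⁻¹ 1 0 = -α 1 0 ∧ α⁻¹ 1 1 = α 0 0 := by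
  simp [adjugate_fin_two]

/-- A matrix with first row `(1, 0)` is lower unitriangular. -/
theorem mem_L_of_row {α : SL(2, R)} (h0 : α 0 0 = 1) (h1 : α 0 1 = 0) : α ∈ L R := by
  refine ⟨α 1 0, ?_⟩
  have := det_eq α
  rw [h0, h1] at this
  ext i j
  fin_cases i <;> fin_cases j <;> simp [coe_lower, h0, h1]
  linear_combination -this

theorem mul_upper_row (α : SL(2, R)) (k : R) :
    (α * upper k) 0 0 = α 0 0 ∧ (α * upper k) 0 1 = α 0 1 + α 0 0 * k := by
  constructor <;> simp [coe_upper, mul_apply, Fin.sum_univ_two]; ring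

theorem mul_lower_row (α : SL(2, R)) (k : R) :
    (α * lower k) 0 0 = α 0 0 + α 0 1 * k ∧ (α * lower k) 0 1 = α 0 1 := by
  constructor <;> simp [coe_lower, mul_apply, Fin.sum_univ_two]

/-- Words of length five starting and ending with a lower unitriangular factor. -/
theorem exists_lower_word {α : SL(2, R)} {x η : R} (hη : IsUnit η)
    (hx : α 0 1 ∣ α 0 0 - x) (hv : x ∣ α 0 1 - η) :
    ∃ k₁ k₂ k₃ k₄ k₅, α = lower k₁ * upper k₂ * lower k₃ * upper k₄ * lower k₅ := by
  obtain ⟨k, hk⟩ := hx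
  obtain ⟨l, hl⟩ := hv
  obtain ⟨e, he⟩ := hη.exists_right_inv
  set β := α * lower (-k) * upper (-l) * lower (e * (1 - x)) * upper (-η) with hβ
  have a0 := mul_lower_row α (-k)
  have a1 := mul_upper_row (α * lower (-k)) (-l)
  have a2 := mul_lower_row (α * lower (-k) * upper (-l)) (e * (1 - x))
  have a3 := mul_upper_row (α * lower (-k) * upper (-l) * lower (e * (1 - x))) (-η)
  have h01 : (α * lower (-k)) 0 0 = x := by rw [a0.1]; linear_combination hk
  have h11 : (α * lower (-k) * upper (-l)) 0 1 = η := by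
    rw [a1.2, a0.2, h01]; linear_combination hl
  have h20 : (α * lower (-k) * upper (-l) * lower (e * (1 - x))) 0 0 = 1 := by
    rw [a2.1, h11, a1.1, h01]; linear_combination (1 - x) * he
  obtain ⟨m, hm⟩ := mem_L_of_row (α := β) (by rw [hβ, a3.1, h20])
    (by rw [hβ, a3.2, h20, a2.2, h11]; ring)
  refine ⟨m, η, -(e * (1 - x)), l, k, ?_⟩
  have h1 : lower (-(e * (1 - x))) = (lower (e * (1 - x)))⁻¹ := (lower_inv _).symm
  have h2 : upper l = (upper (-l))⁻¹ := by rw [upper_inv, neg_neg]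
  have h3 : lower k = (lower (-k))⁻¹ := by rw [lower_inv, neg_neg]
  have h4 : upper η = (upper (-η))⁻¹ := by rw [upper_inv, neg_neg]
  rw [hm, h1, h2, h3, h4, hβ]
  group

/-- Moving a square factor `s ^ 2` across the diagonal. -/
theorem exists_scaling {α β : SL(2, R)} {s x y z d : R}
    (hα : (α : Matrix (Fin 2) (Fin 2) R) = !![1 + s * x, s ^ 2 * y; z, d])
    (hβ : (β : Matrix (Fin 2) (Fin 2) R) = !![1 + s * x, y; s ^ 2 * z, d]) :
    ∃ θ ∈ Q R, α = θ * (weyl⁻¹ * β * weyl) * upper (-(2 * s)) := by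
  refine ⟨_, ⟨s, y - z + x + x * d - s * y * z, -x * d + s * y * z + z, rfl⟩, ?_⟩
  have hd : (1 + s * x) * d - s ^ 2 * y * z = 1 := by
    have := α.det_coe
    rwa [hα, det_fin_two_of] at this
  set t := -x * d + s * y * z + z with ht
  set q := y - z + x + x * d - s * y * z with hq
  have key : scaling s q t * (upper (-s) * α * upper (2 * s)) = upper s * (weyl⁻¹ * β * weyl) := by
    ext i j
    fin_cases i <;> fin_cases j <;>
      simp [coe_scaling, coe_upper, coe_weyl, hα, hβ, adjugate_fin_two,
        mul_apply, Fin.sum_univ_two, vecHead, vecTail]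
    all_goals (clear_value t q; grind)
  have : weyl⁻¹ * β * weyl = (upper s)⁻¹ * (scaling s q t * (upper (-s) * α * upper (2 * s))) := by
    rw [key]; group
  rw [this, ← upper_inv (2 * s), ← upper_inv s]
  group

variable (R) in

/-- The conjugate by the Weyl element of the words in `exists_lower_word`. -/
def upperWords : Set SL(2, R) := U R * L R * U R * L R * U R

variable (R) in

/-- The words in `exists_lower_word`. -/
def lowerWords : Set SL(2, R) := L R * U R * L R * U R * L R

theorem mem_lowerWords {α : SL(2, R)} {x η : R} (hη : IsUnit η)
    (hx : α 0 1 ∣ α 0 0 - x) (hv : x ∣ α 0 1 - η) : α ∈ lowerWords R := by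
  obtain ⟨k₁, k₂, k₃, k₄, k₅, rfl⟩ := exists_lower_word hη hx hv
  exact Set.mul_mem_mul (Set.mul_mem_mul (Set.mul_mem_mul (Set.mul_mem_mul (lower_mem_L _)
    (upper_mem_U _)) (lower_mem_L _)) (upper_mem_U _)) (lower_mem_L _)

theorem weyl_conj_mul_upper_mem {α : SL(2, R)} {x η : R} (hη : IsUnit η)
    (hx : α 0 1 ∣ α 0 0 - x) (hv : x ∣ α 0 1 - η) (k : R) :
    weyl⁻¹ * α * weyl * upper k ∈ upperWords R := by
  obtain ⟨k₁, k₂, k₃, k₄, k₅, rfl⟩ := exists_lower_word hη hx hv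
  have : weyl⁻¹ * (lower k₁ * upper k₂ * lower k₃ * upper k₄ * lower k₅) * weyl * upper k =
      upper (-k₁) * lower (-k₂) * upper (-k₃) * lower (-k₄) * upper (-k₅ + k) := by
    rw [← upper_mul_upper]
    simp only [← weyl_conj_lower, ← weyl_conj_upper]
    group
  rw [this]
  exact Set.mul_mem_mul (Set.mul_mem_mul (Set.mul_mem_mul (Set.mul_mem_mul (upper_mem_U _)
    (lower_mem_L _)) (upper_mem_U _)) (lower_mem_L _)) (upper_mem_U _)

theorem unit_dvd_mem_lowerWords {α : SL(2, R)} {ε : R} (hε : IsUnit ε)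
    (h : α 0 1 ∣ α 0 0 - ε) : α ∈ lowerWords R :=
  mem_lowerWords isUnit_one h hε.dvd

theorem exists_row {a b : R} (h : IsCoprime a b) : ∃ α : SL(2, R), α 0 0 = a ∧ α 0 1 = b := by
  obtain ⟨x, y, hxy⟩ := h
  exact ⟨⟨!![a, b; -y, x], by rw [det_fin_two_of]; linear_combination hxy⟩, rfl, rfl⟩

theorem isCoprime_row (α : SL(2, R)) : IsCoprime (α 0 0) (α 0 1) :=
  ⟨α 1 1, -α 1 0, by linear_combination det_eq α⟩

/-- Partial multiplicativity in the second entry of the first row, available when the relevant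
difference is a unit times a square modulo the first entry. -/
theorem mem_of_row_mul {α β : SL(2, R)} {x y u s ε : R} (hu : IsUnit u) (hε : IsUnit ε)
    (hα : α 0 1 = x * y) (h0 : β 0 0 = α 0 0) (hβ : β 0 1 = y) (hx : x ∣ α 0 0 - ε)
    (hs : α 0 0 ∣ x * y - y - u * s ^ 2) :
    α ∈ Q R * upperWords R * {β} * U R := by
  obtain ⟨k, hk⟩ := hs
  set a := α 0 0 with ha
  set c := β 1 0
  set d := β 1 1
  have hdβ : a * d - y * c = 1 := by rw [← h0, ← hβ]; exact det_eq β
  set α' := α * upper (-k) with hα'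
  have hα'0 : α' 0 0 = a := (mul_upper_row α (-k)).1
  have hα'1 : α' 0 1 = y + u * s ^ 2 := by
    rw [hα', (mul_upper_row α (-k)).2, hα]; linear_combination hk
  set γ := α' * β⁻¹ with hγ
  have hγ0 : γ 0 0 = 1 + s * (-(c * u * s)) := by
    rw [hγ, mul_entry, (inv_entries β).1, (inv_entries β).2.2.1, hα'0, hα'1]
    linear_combination hdβ
  have hγ1 : γ 0 1 = s ^ 2 * (u * a) := by
    rw [hγ, mul_entry, (inv_entries β).2.1, (inv_entries β).2.2.2, hα'0, hα'1, h0, hβ]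
    ring
  have hdγ := det_eq γ
  rw [hγ0, hγ1] at hdγ
  let δ : SL(2, R) := ⟨!![1 + s * (-(c * u * s)), u * a; s ^ 2 * γ 1 0, γ 1 1], by
    rw [det_fin_two_of]; linear_combination hdγ⟩
  obtain ⟨θ, hθ, hθγ⟩ := exists_scaling (α := γ) (β := δ)
    ((eta_fin_two _).trans (by rw [hγ0, hγ1])) rfl
  have hδ := weyl_conj_mul_upper_mem (α := δ) (x := x) (hu.mul hε)
    (by
      obtain ⟨v, hv⟩ := hu.exists_right_inv
      refine ⟨v * (d - x * d + c * k), ?_⟩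
      change 1 + s * (-(c * u * s)) - x = u * a * _
      linear_combination -(a * (d - x * d + c * k)) * hv + c * hk - (1 - x) * hdβ)
    (by
      change x ∣ u * a - u * ε
      rw [← mul_sub]
      exact hx.mul_left u) (-(2 * s))
  have : α = θ * (weyl⁻¹ * δ * weyl * upper (-(2 * s))) * β * upper k := by
    have h1 : α = α' * upper k := by
      rw [hα', ← upper_inv]; group
    rw [h1]
    have h2 : α' = γ * β := by rw [hγ]; group
    rw [h2, hθγ]
    group
  rw [this]
  exact Set.mul_mem_mul (Set.mul_mem_mul (Set.mul_mem_mul hθ hδ) rfl) (upper_mem_U _)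

variable (R) in

/-- A set covering all powers whose first row is suitably congruent to units. -/
def powerWords : Set SL(2, R) :=
  Q R * upperWords R * (Q R * upperWords R * lowerWords R) * U R * L R

theorem covered_powerWords : Covered 23 (powerWords R) := by
  have hU : Covered 5 (upperWords R) :=
    (((covered_U.mul covered_L).mul covered_U).mul covered_L).mul covered_U
  have hL : Covered 5 (lowerWords R) :=
    (((covered_L.mul covered_U).mul covered_L).mul covered_U).mul covered_L
  exact (((covered_Q.mul hU).mul ((covered_Q.mul hU).mul hL)).mul covered_U).mul covered_L

theorem U_mul_U : U R * U R ⊆ U R := by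
  rintro _ ⟨_, ⟨x, rfl⟩, _, ⟨y, rfl⟩, rfl⟩
  exact ⟨x + y, (upper_mul_upper x y).symm⟩

/-- A matrix whose second entry in the first row factors as `x * y * z`, with the first entry
congruent to a unit modulo each factor, lies in a set with few parameters. -/
theorem mem_of_row_mul_mul {α : SL(2, R)} {x y z ε₁ ε₂ ε₃ : R} (h₁ : IsUnit ε₁)
    (h₂ : IsUnit ε₂) (h₃ : IsUnit ε₃) (hα : α 0 1 = x * (y * z)) (hx : x ∣ α 0 0 - ε₁)
    (hy : y ∣ α 0 0 - ε₂) (hz : z ∣ α 0 0 - ε₃)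
    (hsq : ∀ w, ∃ u s, IsUnit u ∧ α 0 0 ∣ w - u * s ^ 2) :
    α ∈ Q R * upperWords R * (Q R * upperWords R * lowerWords R) * U R := by
  have hc := isCoprime_row α
  rw [hα] at hc
  obtain ⟨β, hβ0, hβ1⟩ := exists_row hc.of_mul_right_right
  obtain ⟨γ, hγ0, hγ1⟩ := exists_row hc.of_mul_right_right.of_mul_right_right
  obtain ⟨u, s, hu, hs⟩ := hsq (x * (y * z) - y * z)
  obtain ⟨u', s', hu', hs'⟩ := hsq (y * z - z)
  have hγ : γ ∈ lowerWords R := unit_dvd_mem_lowerWords h₃ (by rwa [hγ0, hγ1])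
  have hβ := mem_of_row_mul hu' h₂ hβ1 (hγ0.trans hβ0.symm) hγ1 (by rwa [hβ0])
    (by rwa [hβ0])
  obtain ⟨_, ⟨θ, hθ, β', hβ', rfl⟩, τ, hτ, hατ⟩ := mem_of_row_mul hu h₁ hα hβ0 hβ1 hx hs
  obtain ⟨_, ⟨θ', hθ', γ', hγ', rfl⟩, τ', hτ', hβτ⟩ := hβ
  rw [Set.mem_singleton_iff] at hβ' hγ'
  have : α = θ * (θ' * γ) * (τ' * τ) := by
    rw [← hατ, hβ', ← hβτ, hγ']
    simp only [mul_assoc]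
  rw [this]
  exact Set.mul_mem_mul (Set.mul_mem_mul hθ (Set.mul_mem_mul hθ' hγ))
    (U_mul_U (Set.mul_mem_mul hτ' hτ))

theorem exists_pow_eq (α : SL(2, R)) (n : ℕ) :
    ∃ f g : R, (α ^ n) 0 0 = f * α 0 0 + g ∧ (α ^ n) 0 1 = f * α 0 1 ∧
      (α ^ n) 1 0 = f * α 1 0 ∧ (α ^ n) 1 1 = f * α 1 1 + g := by
  induction n with
  | zero => exact ⟨0, 1, by simp⟩
  | succ n ih =>
    obtain ⟨f, g, h00, h01, h10, h11⟩ := ih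
    have hd := det_eq α
    refine ⟨f * (α 0 0 + α 1 1) + g, -f, ?_, ?_, ?_, ?_⟩ <;>
      rw [pow_succ, mul_entry] <;> simp only [h00, h01, h10, h11] <;> grind

theorem exists_pow_entries (α : SL(2, R)) (n : ℕ) :
    ∃ f g : R, (α ^ n) 0 0 = f * α 0 0 + g ∧ (α ^ n) 0 1 = f * α 0 1 ∧
      f ∣ (g - 1) * (g + 1) := by
  obtain ⟨f, g, h00, h01, h10, h11⟩ := exists_pow_eq α n
  have hd := det_eq (α ^ n)
  have hα := det_eq α
  rw [h00, h01, h10, h11] at hd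
  exact ⟨f, g, h00, h01, -(f + (α 0 0 + α 1 1) * g), by grind⟩

theorem dvd_pow_sub (α : SL(2, R)) (n : ℕ) : α 0 1 ∣ (α ^ n) 0 0 - α 0 0 ^ n := by
  induction n with
  | zero => simp
  | succ n ih =>
    obtain ⟨f, g, -, h1, -⟩ := exists_pow_entries α n
    have : (α ^ (n + 1)) 0 0 = (α ^ n) 0 0 * α 0 0 + (α ^ n) 0 1 * α 1 0 := by
      rw [pow_succ, mul_entry]
    obtain ⟨k, hk⟩ := ih
    refine ⟨k * α 0 0 + f * α 1 0, ?_⟩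
    rw [this, h1, pow_succ]
    linear_combination α 0 0 * hk

end Families

section FiniteField
variable {F : Type*} [Field F] [Finite F]

theorem finrank_adjoinRoot {F : Type*} [Field F] {a : F[X]} (ha : a ≠ 0) :
    Module.finrank F (AdjoinRoot a) = a.natDegree := by
  rw [(AdjoinRoot.powerBasis ha).finrank, AdjoinRoot.powerBasis_dim]

/-- Modulo an irreducible polynomial of odd degree, every polynomial is a constant times a
square. -/
theorem exists_dvd_sub_unit_mul_sq (hF : Odd (Nat.card F)) {a : F[X]} (ha : Irreducible a)
    (hodd : Odd a.natDegree) (w : F[X]) : ∃ u s, IsUnit u ∧ a ∣ w - u * s ^ 2 := by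
  classical
  have := Fact.mk ha
  have := finite_adjoinRoot ha.ne_zero
  have := Fintype.ofFinite F
  have := Fintype.ofFinite (AdjoinRoot a)
  have hchar : ringChar F ≠ 2 := by
    intro h
    have := FiniteField.even_card_iff_char_two.mp h
    rw [Nat.odd_iff, Nat.card_eq_fintype_card] at hF
    omega
  obtain ⟨u, hu⟩ := FiniteField.exists_nonsquare hchar
  have hu0 : u ≠ 0 := by rintro rfl; exact hu IsSquare.zero
  have hu' : ¬ IsSquare (algebraMap F (AdjoinRoot a) u) := by
    rintro ⟨s, hs⟩
    have hN := congrArg (Algebra.norm F) hs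
    rw [Algebra.norm_algebraMap, map_mul, finrank_adjoinRoot ha.ne_zero] at hN
    obtain ⟨k, hk⟩ := hodd
    refine hu ⟨Algebra.norm F s / u ^ k, ?_⟩
    rw [hk] at hN
    field_simp
    linear_combination hN
  have key (v : F) (hv : v ≠ 0) (s : F[X])
      (h : AdjoinRoot.mk a w = algebraMap F (AdjoinRoot a) v * AdjoinRoot.mk a s ^ 2) :
      ∃ u s, IsUnit u ∧ a ∣ w - u * s ^ 2 := by
    refine ⟨C v, s, isUnit_C.mpr hv.isUnit, AdjoinRoot.mk_eq_mk.mp ?_⟩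
    rw [h, map_mul, map_pow, AdjoinRoot.mk_C, AdjoinRoot.algebraMap_eq]
  by_cases hw : IsSquare (AdjoinRoot.mk a w)
  · obtain ⟨s, hs⟩ := hw
    obtain ⟨s, rfl⟩ := AdjoinRoot.mk_surjective s
    exact key 1 one_ne_zero s (by rw [hs, map_one, one_mul, sq])
  · have hwu : IsSquare (algebraMap F (AdjoinRoot a) u * AdjoinRoot.mk a w) := by
      have h1 := quadraticChar_neg_one_iff_not_isSquare.mpr hw
      have h2 := quadraticChar_neg_one_iff_not_isSquare.mpr hu'
      rw [← quadraticChar_one_iff_isSquare, map_mul, h1, h2]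
      · norm_num
      · refine mul_ne_zero ?_ ?_
        · rintro h; exact hu' (h ▸ IsSquare.zero)
        · rintro h; exact hw (h ▸ IsSquare.zero)
    obtain ⟨s, hs⟩ := hwu
    obtain ⟨s, rfl⟩ := AdjoinRoot.mk_surjective s
    refine key u⁻¹ (inv_ne_zero hu0) s ?_
    rw [sq, ← hs, ← mul_assoc, ← map_mul, inv_mul_cancel₀ hu0, map_one, one_mul]

/-- Modulo an irreducible polynomial, the norm of a unit is a constant. -/
theorem exists_dvd_pow_sub {a b : F[X]} (hb : Irreducible b) (hab : ¬ b ∣ a) :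
    ∃ ε, IsUnit ε ∧ b ∣ a ^ (∑ i ∈ Finset.range b.natDegree, Nat.card F ^ i) - ε := by
  have := Fact.mk hb
  have := finite_adjoinRoot hb.ne_zero
  have := Fintype.ofFinite F
  have h := FiniteField.algebraMap_norm_eq_pow_sum F (AdjoinRoot b) (AdjoinRoot.mk b a)
  rw [finrank_adjoinRoot hb.ne_zero] at h
  refine ⟨C (Algebra.norm F (AdjoinRoot.mk b a)), isUnit_C.mpr ?_, AdjoinRoot.mk_eq_mk.mp ?_⟩
  · rw [isUnit_iff_ne_zero, Algebra.norm_ne_zero_iff, Ne, AdjoinRoot.mk_eq_zero]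
    exact hab
  · rw [map_pow, ← h, AdjoinRoot.mk_C, AdjoinRoot.algebraMap_eq]

theorem lowerWords_subset_powerWords {R : Type*} [CommRing R] : lowerWords R ⊆ powerWords R := by
  intro α hα
  have hU : (1 : SL(2, R)) ∈ U R :=
    ⟨0, by ext i j; fin_cases i <;> fin_cases j <;> simp [coe_upper]⟩
  have hL : (1 : SL(2, R)) ∈ L R :=
    ⟨0, by ext i j; fin_cases i <;> fin_cases j <;> simp [coe_lower]⟩
  have hQ : (1 : SL(2, R)) ∈ Q R := ⟨0, 0, 0, by
    ext i j; fin_cases i <;> fin_cases j <;> simp [coe_upper, coe_scaling, adjugate_fin_two]⟩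
  have hW : (1 : SL(2, R)) ∈ upperWords R := by
    simpa [upperWords] using
      Set.mul_mem_mul (Set.mul_mem_mul (Set.mul_mem_mul (Set.mul_mem_mul hU hL) hU) hL) hU
  simpa [powerWords] using Set.mul_mem_mul (Set.mul_mem_mul (Set.mul_mem_mul
    (Set.mul_mem_mul hQ hW) (Set.mul_mem_mul (Set.mul_mem_mul hQ hW) hα)) hU) hL

/-- If the first entry of a power is congruent to a unit modulo the second entry of the base, the
power lies in `powerWords`. -/
theorem pow_mem_powerWords (hF : Odd (Nat.card F)) {α : SL(2, F[X])} {j : ℕ} {ε : F[X]}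
    (hb : α 0 1 ≠ 0) (hε : IsUnit ε) (h : α 0 1 ∣ α 0 0 ^ j - ε) :
    α ^ j ∈ powerWords F[X] := by
  obtain ⟨f, g, h0, h1, hfg⟩ := exists_pow_entries α j
  rcases eq_or_ne f 0 with rfl | hf
  · rw [zero_mul] at h1
    have hu : IsUnit ((α ^ j) 0 0) := by
      have := isCoprime_row (α ^ j)
      rwa [h1, isCoprime_zero_right] at this
    exact lowerWords_subset_powerWords (unit_dvd_mem_lowerWords hu (by simp))
  obtain ⟨f₁, f₂, hf₁, hf₂, rfl⟩ := exists_dvd_and_dvd_of_dvd_mul hfg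
  have hne : (α ^ j) 0 1 ≠ 0 := by rw [h1]; exact mul_ne_zero hf hb
  obtain ⟨N, hN⟩ := exists_irreducible_dvd_sub hne (isCoprime_row (α ^ j))
  obtain ⟨P, hP, hdeg, k, hk⟩ := hN (2 * N + 1) (by omega)
  have r0 := (mul_lower_row (α ^ j) k).1
  have r1 := (mul_lower_row (α ^ j) k).2
  rw [← hk, add_sub_cancel] at r0
  have hPf : P - g = (f₁ * f₂) * (α 0 0 + α 0 1 * k) := by
    linear_combination hk + h0 + k * h1
  have hmem : α ^ j * lower k ∈ Q F[X] * upperWords F[X] *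
      (Q F[X] * upperWords F[X] * lowerWords F[X]) * U F[X] := by
    refine mem_of_row_mul_mul (x := f₁) (y := f₂) (z := α 0 1) isUnit_one isUnit_one.neg hε
      (by rw [r1, h1, mul_assoc]) ?_ ?_ ?_ ?_
    · rw [r0, ← sub_add_sub_cancel P g, hPf, mul_assoc]
      exact dvd_add (dvd_mul_right _ _) hf₁
    · rw [r0, ← sub_add_sub_cancel P g, hPf, mul_comm f₁, mul_assoc, sub_neg_eq_add]
      exact dvd_add (dvd_mul_right _ _) hf₂
    · rw [r0, ← sub_add_sub_cancel P ((α ^ j) 0 0), hk, ← sub_add_sub_cancel _ (α 0 0 ^ j), h1]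
      exact dvd_add ((dvd_mul_left _ _).mul_right _) (dvd_add (dvd_pow_sub α j) h)
    · rw [r0]
      exact exists_dvd_sub_unit_mul_sq hF hP (by rw [hdeg]; exact ⟨N, rfl⟩)
  have : α ^ j = α ^ j * lower k * lower (-k) := by rw [← lower_inv]; group
  rw [this]
  exact Set.mul_mem_mul hmem (lower_mem_L _)

/-- Matrices with irreducible off-diagonal entries of consecutive degrees are products of two
members of `powerWords`, up to inversion and transposition. -/
theorem mem_of_irreducible (hF : Odd (Nat.card F)) {α : SL(2, F[X])} {r : ℕ}
    (hb : Irreducible (α 0 1)) (hc : Irreducible (α 1 0)) (hbr : (α 0 1).natDegree = r)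
    (hcr : (α 1 0).natDegree = r + 1) :
    α ∈ (powerWords F[X])⁻¹ * {β | β.transpose ∈ powerWords F[X]} := by
  have hcop := isCoprime_row α
  have hcop' := isCoprime_row α.transpose
  obtain ⟨ε, hε, hεb⟩ := exists_dvd_pow_sub (a := α 0 0) hb
    fun h => hb.not_isUnit (hcop.isUnit_of_dvd' h dvd_rfl)
  obtain ⟨ε', hε', hεc⟩ := exists_dvd_pow_sub (a := α 0 0) hc
    fun h => hc.not_isUnit (hcop'.isUnit_of_dvd' h dvd_rfl)
  rw [hbr] at hεb
  rw [hcr, Finset.sum_range_succ'] at hεc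
  set m := ∑ i ∈ Finset.range r, Nat.card F ^ i with hm
  have hn : ∑ i ∈ Finset.range r, Nat.card F ^ (i + 1) + Nat.card F ^ 0 = m * Nat.card F + 1 := by
    rw [hm, Finset.sum_mul]; simp [pow_succ]
  rw [hn] at hεc
  have h1 : α ^ (m * Nat.card F) ∈ powerWords F[X] := by
    refine pow_mem_powerWords hF hb.ne_zero (hε.pow (Nat.card F)) ?_
    rw [pow_mul]
    exact hεb.trans (sub_dvd_pow_sub_pow _ _ _)
  have h2 : α.transpose ^ (m * Nat.card F + 1) ∈ powerWords F[X] :=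
    pow_mem_powerWords hF hc.ne_zero hε' hεc
  refine ⟨(α ^ (m * Nat.card F))⁻¹, Set.inv_mem_inv.mpr h1, α ^ (m * Nat.card F + 1), ?_, ?_⟩
  · rw [Set.mem_ofPred_eq]
    convert h2
    apply Subtype.ext
    simp [SpecialLinearGroup.coe_transpose, transpose_pow]
  · simp only [pow_succ]
    group

theorem mem_of_ne_zero (hF : Odd (Nat.card F)) {α : SL(2, F[X])} (ha : α 0 0 ≠ 0) :
    α ∈ L F[X] * ((powerWords F[X])⁻¹ * {β | β.transpose ∈ powerWords F[X]}) * U F[X] := by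
  obtain ⟨N, hN⟩ := exists_irreducible_dvd_sub ha (isCoprime_row α).symm
  obtain ⟨N', hN'⟩ := exists_irreducible_dvd_sub ha (isCoprime_row α.transpose).symm
  obtain ⟨P, hP, hPd, k, hk⟩ := hN (N + N') (by omega)
  obtain ⟨P', hP', hPd', l, hl⟩ := hN' (N + N' + 1) (by omega)
  have hl : P' - α 1 0 = α 0 0 * l := hl
  have e00 (β : SL(2, F[X])) (x y : F[X]) :
      (lower x * β * upper y) 0 1 = β 0 1 + β 0 0 * y ∧
      (lower x * β * upper y) 1 0 = β 1 0 + β 0 0 * x := by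
    simp only [mul_entry, coe_lower, coe_upper]
    simp
    constructor <;> ring
  have hP1 : (lower l * α * upper k) 0 1 = P := by rw [(e00 _ _ _).1, ← hk]; ring
  have hP1' : (lower l * α * upper k) 1 0 = P' := by rw [(e00 _ _ _).2, ← hl]; ring
  have := mem_of_irreducible hF (α := lower l * α * upper k) (r := N + N')
    (by rwa [hP1]) (by rwa [hP1']) (by rw [hP1, hPd]) (by rw [hP1', hPd'])
  have hα : α = lower (-l) * (lower l * α * upper k) * upper (-k) := by
    rw [← lower_inv, ← upper_inv]; group
  rw [hα]
  exact Set.mul_mem_mul (Set.mul_mem_mul (lower_mem_L _) this) (upper_mem_U _)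

theorem mem_words (hF : Odd (Nat.card F)) (α : SL(2, F[X])) :
    α ∈ L F[X] * ((powerWords F[X])⁻¹ * {β | β.transpose ∈ powerWords F[X]}) * U F[X] * L F[X] := by
  obtain ⟨k, hk⟩ : ∃ k : F[X], (α * lower k) 0 0 ≠ 0 := by
    by_contra! h
    have h0 := h 0
    have h1 := h 1
    rw [(mul_lower_row _ _).1] at h0 h1
    have := det_eq α
    simp_all
  have hα : α = α * lower k * lower (-k) := by rw [← lower_inv]; group
  rw [hα]
  exact Set.mul_mem_mul (mem_of_ne_zero hF hk) (lower_mem_L _)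

theorem covered_univ (hF : Odd (Nat.card F)) : Covered 52 (Set.univ : Set SL(2, F[X])) := by
  have h : Covered (1 + (23 + 23) + 1 + 1) _ :=
    ((covered_L.mul (covered_powerWords.inv.mul
      (covered_powerWords (R := F[X])).transpose)).mul covered_U).mul covered_L
  exact (h.mono fun α _ => mem_words hF α).of_le (by norm_num)

end FiniteField

end PolyFamily

/-- **SL₂(𝔽_q[T]) is a polynomial family with 52 parameters.**
Here `F` is a finite field whose cardinality is odd (i.e. a power of an odd prime `p`),
and `A = F[T]` is the polynomial ring over `F`. -/
theorem sl2_polynomial_family_52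
    (F : Type) [Field F] [Fintype F] (hq : Odd (Fintype.card F)) :
    ∃ P₁ P₂ P₃ P₄ : MvPolynomial (Fin 52) (Polynomial F),
      {x : Polynomial F × Polynomial F × Polynomial F × Polynomial F |
          x.1 * x.2.2.2 - x.2.1 * x.2.2.1 = 1} =
        Set.range (fun v : Fin 52 → Polynomial F =>
          (MvPolynomial.eval v P₁, MvPolynomial.eval v P₂,
           MvPolynomial.eval v P₃, MvPolynomial.eval v P₄)) := by
  obtain ⟨g, hg⟩ := PolyFamily.covered_univ (F := F) (by rwa [Nat.card_eq_fintype_card])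
  refine ⟨g 0 0, g 0 1, g 1 0, g 1 1, ?_⟩
  ext ⟨a, b, c, d⟩
  constructor
  · intro h
    obtain ⟨v, hv⟩ := hg ⟨!![a, b; c, d], by rw [Matrix.det_fin_two_of]; exact h⟩ (Set.mem_univ _)
    have e (i j : Fin 2) : MvPolynomial.eval v (g i j) = !![a, b; c, d] i j :=
      congrArg (fun β : SL(2, F[X]) => β i j) hv
    exact ⟨v, by simp [e]⟩
  · rintro ⟨v, hv⟩
    simp only [Prod.mk.injEq] at hv
    obtain ⟨rfl, rfl, rfl, rfl⟩ := hv
    have := congrArg (MvPolynomial.eval v) (PolyFamily.det_eq g)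
    simpa using this
end

section
/- Let q be a power of an odd prime and let A = 𝔽_q[T]. Then UM₂(A), the set of unimodular pairs in A², is a polynomial family with 52 parameters: there exist polynomials P₁, P₂ in 52 variables with coefficients in A such that the set of pairs (P₁(x), P₂(x)), as x ranges over A⁵², is exactly the set of pairs (a, b) ∈ A² for which there exist c, d ∈ A with a·d − b·c = 1. -/
open Polynomial

section SpecialLinear

open Matrix

variable {R S : Type*} [CommRing R] [CommRing S]

/-- The upper elementary matrix with off-diagonal entry `x`. -/
def upperElem (x : R) : SpecialLinearGroup (Fin 2) R :=
  ⟨!![1, x; 0, 1], by simp [det_fin_two_of]⟩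

/-- The lower elementary matrix with off-diagonal entry `x`. -/
def lowerElem (x : R) : SpecialLinearGroup (Fin 2) R :=
  ⟨!![1, 0; x, 1], by simp [det_fin_two_of]⟩

/-- The transvection `1 + s v wᵀ` with `v = (x, y)` and `w = (-y, x)`. -/
def transvec (x y s : R) : SpecialLinearGroup (Fin 2) R :=
  ⟨!![1 - s * x * y, s * x ^ 2; -(s * y ^ 2), 1 + s * x * y], by
    rw [det_fin_two_of]; ring⟩

/-- The rotation by a quarter turn. -/
def quarterTurn : SpecialLinearGroup (Fin 2) R :=
  ⟨!![0, 1; -1, 0], by simp [det_fin_two_of]⟩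

/-- The second factor in a factorization of the product of `!![g, e² B; K, l]` and
`!![g, e² K; B, l]`, where `g = 1 + e g₁` and `l = 1 + e l₁`. -/
def symmFactor (g₁ l₁ B K e : R) : SpecialLinearGroup (Fin 2) R :=
  ⟨!![(1 + e * B * (1 + e * l₁)) * (1 + e * g₁) ^ 2
        + e ^ 2 * B ^ 2 * (1 - e * (1 + e * g₁) * K),
      e * ((1 + e * B * (1 + e * l₁)) * (1 + e * (1 + e * g₁) * K) - e ^ 4 * B ^ 2 * K ^ 2);
      (g₁ + l₁ + e * g₁ * l₁) * ((1 + e * l₁) * (1 + e * g₁) + 1) + B * (1 + e * l₁)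
        + (1 + e * g₁) * K - e * B * (1 + e * l₁) * (1 + e * g₁) * K,
      (1 + e * l₁) ^ 2 * (1 + e * (1 + e * g₁) * K)
        + (1 - e * B * (1 + e * l₁)) * e ^ 2 * K ^ 2], by
    rw [det_fin_two_of]; ring⟩

/-- A five-parameter family that moves a square factor from one off-diagonal entry
to the other. -/
def squareShift (g₁ l₁ B K e : R) : SpecialLinearGroup (Fin 2) R :=
  transvec (1 + e * g₁) (e ^ 2 * K) (-1) * transvec B (1 + e * l₁) (-1)
    * transvec (1 + e * g₁) (e ^ 2 * K) (-1) * quarterTurn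
    * (transvec (1 + e * g₁) K (-e) * symmFactor g₁ l₁ B K e)⁻¹

/-- If `g₁ + l₁ + e g₁ l₁ = e B K`, then `squareShift` moves `e ^ 2` between the two
off-diagonal entries. -/
theorem squareShift_mul {g₁ l₁ B K e : R} (δ β : SpecialLinearGroup (Fin 2) R)
    (h : g₁ + l₁ + e * g₁ * l₁ = e * B * K)
    (hδ : δ.1 = !![1 + e * g₁, B; e ^ 2 * K, 1 + e * l₁])
    (hβ : β.1 = !![1 + e * g₁, e ^ 2 * B; K, 1 + e * l₁]) :
    squareShift g₁ l₁ B K e * β = δ := by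
  have h₄ : transvec (1 + e * g₁) (e ^ 2 * K) (-1) * transvec B (1 + e * l₁) (-1)
      * transvec (1 + e * g₁) (e ^ 2 * K) (-1) * quarterTurn = δ * δ.transpose := by
    apply Subtype.ext
    simp only [Matrix.SpecialLinearGroup.coe_mul, Matrix.SpecialLinearGroup.coe_transpose, hδ]
    simp only [transvec, quarterTurn]
    ext i j
    fin_cases i <;> fin_cases j <;>
      simp [Matrix.mul_apply, Fin.sum_univ_two] <;> grind
  have h₅ : transvec (1 + e * g₁) K (-e) * symmFactor g₁ l₁ B K e = β * δ.transpose := by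
    apply Subtype.ext
    simp only [Matrix.SpecialLinearGroup.coe_mul, Matrix.SpecialLinearGroup.coe_transpose, hδ,
      hβ]
    simp only [transvec, symmFactor]
    ext i j
    fin_cases i <;> fin_cases j <;>
      simp [Matrix.mul_apply, Fin.sum_univ_two] <;> grind
  rw [squareShift, h₄, h₅]
  group

/-- A matrix of determinant one has powers of the form `!![g, x b; x c, l]`. -/
theorem exists_pow_entries {a b c d : R} (hdet : a * d - b * c = 1) (h : ℕ) :
    ∃ g l x : R, g - l = x * (a - d) ∧ g * l - x ^ 2 * (b * c) = 1 ∧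
      b * c ∣ g - a ^ h := by
  induction h with
  | zero => exact ⟨1, 1, 0, by ring, by ring, by simp⟩
  | succ h ih =>
    obtain ⟨g, l, x, h₁, h₂, y, hy⟩ := ih
    refine ⟨g * a + x * (b * c), x * (b * c) + l * d, g + x * d, by linear_combination d * h₁, ?_,
      a * y + x, by linear_combination a * hy⟩
    grind

/-- If `a ^ (2 * h) ≡ 1` modulo `c`, the row `(a ^ (2 * h), b)` is, up to changing the first
entry modulo `b`, in the image of an explicit family with thirteen parameters. -/
theorem exists_squareShift_row {a b c d : R} (hdet : a * d - b * c = 1) (h : ℕ)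
    (hc : c ∣ a ^ (2 * h) - 1) :
    ∃ v : Fin 13 → R, ∃ M : SpecialLinearGroup (Fin 2) R,
      M = squareShift (v 0) (v 1) (v 2) (v 3) (v 4) *
        squareShift (v 5) (v 6) (v 7) (v 8) (v 9) *
        (upperElem (v 10) * lowerElem (v 11) * upperElem (v 12)) ∧
      b ∣ M.1 0 0 - a ^ (2 * h) ∧ M.1 0 1 = b := by
  obtain ⟨g₀, l₀, x, h₁, h₂, y, hy⟩ := exists_pow_entries hdet h
  obtain ⟨z, hz⟩ := hc
  have hg : (g₀ + l₀) * g₀ - 1 = g₀ ^ 2 + x ^ 2 * (b * c) := by linear_combination h₂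
  have hpow : a ^ (2 * h) = (g₀ - b * c * y) ^ 2 := by
    rw [← hy]; ring
  have hgb : (g₀ + l₀) * g₀ - 1 - a ^ (2 * h) =
      b * c * (2 * g₀ * y - b * c * y ^ 2 + x ^ 2) := by
    rw [hg, hpow]; ring
  obtain ⟨k, hk⟩ : ∃ k, (g₀ + l₀) * g₀ - 1 = 1 + c * k :=
    ⟨z + b * (2 * g₀ * y - b * c * y ^ 2 + x ^ 2), by linear_combination hgb + hz⟩
  have hdet' : ((g₀ + l₀) * g₀ - 1) * ((g₀ + l₀) * l₀ - 1)
      - (x * (g₀ + l₀)) ^ 2 * (b * c) = 1 := by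
    linear_combination (g₀ + l₀) ^ 2 * h₂
  let A₁ : SpecialLinearGroup (Fin 2) R :=
    ⟨!![(g₀ + l₀) * g₀ - 1, b; (x * (g₀ + l₀)) ^ 2 * c, (g₀ + l₀) * l₀ - 1], by
      rw [det_fin_two_of]; linear_combination hdet'⟩
  let A : SpecialLinearGroup (Fin 2) R :=
    ⟨!![(g₀ + l₀) * g₀ - 1, x ^ 2 * b; (g₀ + l₀) ^ 2 * c, (g₀ + l₀) * l₀ - 1], by
      rw [det_fin_two_of]; linear_combination hdet'⟩
  let A₂ : SpecialLinearGroup (Fin 2) R :=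
    ⟨!![(g₀ + l₀) * g₀ - 1, (x * (g₀ + l₀)) ^ 2 * b; c, (g₀ + l₀) * l₀ - 1], by
      rw [det_fin_two_of]; linear_combination hdet'⟩
  have e₁ : squareShift (g₀ * (a - d) + 2 * x * (b * c)) (-l₀ * (a - d) + 2 * x * (b * c))
      b ((g₀ + l₀) ^ 2 * c) x * A = A₁ := by
    apply squareShift_mul
    · linear_combination ((a - d) + 2 * x ^ 2 * (b * c) * (a - d)
        - x * (b * c) * (g₀ - l₀ + x * (a - d))) * h₁
        - (x * (a - d) ^ 2 + 4 * x * (b * c)) * h₂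
    · simp only [A₁]
      ext i j
      fin_cases i <;> fin_cases j <;> simp
      · linear_combination g₀ * h₁ + 2 * h₂
      · ring
      · linear_combination -l₀ * h₁ + 2 * h₂
    · simp only [A]
      ext i j
      fin_cases i <;> fin_cases j <;> simp
      · linear_combination g₀ * h₁ + 2 * h₂
      · linear_combination -l₀ * h₁ + 2 * h₂
  have e₂ : squareShift (-g₀) (-l₀) (-(x ^ 2 * b)) (-c) (g₀ + l₀) * (-A₂) = -A := by
    apply squareShift_mul
    · linear_combination (g₀ + l₀) * h₂
    · rw [Matrix.SpecialLinearGroup.coe_neg]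
      simp only [A]
      ext i j
      fin_cases i <;> fin_cases j <;> simp <;> ring
    · rw [Matrix.SpecialLinearGroup.coe_neg]
      simp only [A₂]
      ext i j
      fin_cases i <;> fin_cases j <;> simp <;> ring
  have e₂' : squareShift (-g₀) (-l₀) (-(x ^ 2 * b)) (-c) (g₀ + l₀) * A₂ = A := by
    rwa [mul_neg, neg_inj] at e₂
  have e₃ : upperElem k * lowerElem c *
      upperElem ((x * (g₀ + l₀)) ^ 2 * b - k * ((g₀ + l₀) * l₀ - 1)) = A₂ := by
    apply Subtype.ext
    simp only [Matrix.SpecialLinearGroup.coe_mul]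
    simp only [upperElem, lowerElem, A₂]
    ext i j
    fin_cases i <;> fin_cases j <;>
      simp [Matrix.mul_apply, Fin.sum_univ_two]
    · linear_combination -hk
    · linear_combination k * ((g₀ + l₀) * l₀ - 1) * hk - k * hdet'
    · linear_combination ((g₀ + l₀) * l₀ - 1) * hk - hdet'
  refine ⟨![g₀ * (a - d) + 2 * x * (b * c), -l₀ * (a - d) + 2 * x * (b * c),
      b, (g₀ + l₀) ^ 2 * c, x, -g₀, -l₀, -(x ^ 2 * b), -c, g₀ + l₀, k, c,
      (x * (g₀ + l₀)) ^ 2 * b - k * ((g₀ + l₀) * l₀ - 1)], A₁, ?_, ?_, rfl⟩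
  · rw [← e₁, ← e₂', ← e₃, ← mul_assoc]
    rfl
  · exact ⟨c * (2 * g₀ * y - b * c * y ^ 2 + x ^ 2), by
      simp only [A₁]; simp; linear_combination hgb⟩

/-- The family of matrices whose first rows run through all unimodular rows. -/
def rowFamily (v : Fin 52 → R) : SpecialLinearGroup (Fin 2) R :=
  squareShift (v 0) (v 1) (v 2) (v 3) (v 4) *
    squareShift (v 5) (v 6) (v 7) (v 8) (v 9) *
    (upperElem (v 10) * lowerElem (v 11) * upperElem (v 12)) *
    lowerElem (v 13) *
    (upperElem (v 14) * lowerElem (v 15) * upperElem (v 16) * lowerElem (v 17)) *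
    (upperElem (v 18) * lowerElem (v 19) * upperElem (v 20))

theorem map_upperElem (f : R →+* S) (x : R) :
    SpecialLinearGroup.map f (upperElem x) = upperElem (f x) := by
  apply Subtype.ext
  rw [Matrix.SpecialLinearGroup.map_apply_coe]
  ext i j
  fin_cases i <;> fin_cases j <;> simp [upperElem]

theorem map_lowerElem (f : R →+* S) (x : R) :
    SpecialLinearGroup.map f (lowerElem x) = lowerElem (f x) := by
  apply Subtype.ext
  rw [Matrix.SpecialLinearGroup.map_apply_coe]
  ext i j
  fin_cases i <;> fin_cases j <;> simp [lowerElem]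

theorem map_transvec (f : R →+* S) (x y s : R) :
    SpecialLinearGroup.map f (transvec x y s) = transvec (f x) (f y) (f s) := by
  apply Subtype.ext
  rw [Matrix.SpecialLinearGroup.map_apply_coe]
  ext i j
  fin_cases i <;> fin_cases j <;> simp [transvec]

theorem map_quarterTurn (f : R →+* S) :
    SpecialLinearGroup.map f quarterTurn = quarterTurn := by
  apply Subtype.ext
  rw [Matrix.SpecialLinearGroup.map_apply_coe]
  ext i j
  fin_cases i <;> fin_cases j <;> simp [quarterTurn]

theorem map_symmFactor (f : R →+* S) (g₁ l₁ B K e : R) :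
    SpecialLinearGroup.map f (symmFactor g₁ l₁ B K e) =
      symmFactor (f g₁) (f l₁) (f B) (f K) (f e) := by
  apply Subtype.ext
  rw [Matrix.SpecialLinearGroup.map_apply_coe]
  ext i j
  fin_cases i <;> fin_cases j <;> simp [symmFactor]

theorem map_squareShift (f : R →+* S) (g₁ l₁ B K e : R) :
    SpecialLinearGroup.map f (squareShift g₁ l₁ B K e) =
      squareShift (f g₁) (f l₁) (f B) (f K) (f e) := by
  simp only [squareShift, map_mul, map_inv, map_transvec, map_quarterTurn, map_symmFactor,
    map_add, map_one, map_pow, map_neg]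

theorem map_rowFamily (f : R →+* S) (v : Fin 52 → R) :
    SpecialLinearGroup.map f (rowFamily v) = rowFamily (fun i => f (v i)) := by
  simp only [rowFamily, map_mul, map_squareShift, map_upperElem, map_lowerElem]

end SpecialLinear

section MonicSums

theorem finite_setOf_monic_natDegree_eq (F : Type*) [Field F] [Fintype F] (n : ℕ) :
    {p : F[X] | p.Monic ∧ p.natDegree = n}.Finite :=
  Finite.of_equiv _ ((monicEquivDegreeLT n).trans (degreeLTEquiv F n).toEquiv).symm

/-- The finite set of monic polynomials of degree `n` over a finite field. -/
noncomputable def monicsOfDegree (F : Type*) [Field F] [Fintype F] (n : ℕ) : Finset F[X] :=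
  (finite_setOf_monic_natDegree_eq F n).toFinset

open scoped Classical in
/-- The finite set of monic irreducible polynomials of degree `n` over a finite field. -/
noncomputable def irreduciblesOfDegree (F : Type*) [Field F] [Fintype F] (n : ℕ) :
    Finset F[X] :=
  {P ∈ monicsOfDegree F n | Irreducible P}

open scoped Classical in
/-- The finite set of monic irreducible polynomials of degree at most `n` over a finite
field. -/
noncomputable def irreduciblesUpTo (F : Type*) [Field F] [Fintype F] (n : ℕ) :
    Finset F[X] :=
  (Finset.range (n + 1)).biUnion (irreduciblesOfDegree F)

variable {F : Type*} [Field F] [Fintype F]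

theorem mem_monicsOfDegree {n : ℕ} {f : F[X]} :
    f ∈ monicsOfDegree F n ↔ f.Monic ∧ f.natDegree = n := by
  simp [monicsOfDegree]

theorem mem_irreduciblesOfDegree {n : ℕ} {f : F[X]} :
    f ∈ irreduciblesOfDegree F n ↔ f.Monic ∧ f.natDegree = n ∧ Irreducible f := by
  simp [irreduciblesOfDegree, mem_monicsOfDegree, and_assoc]

theorem mem_irreduciblesUpTo {n : ℕ} {f : F[X]} :
    f ∈ irreduciblesUpTo F n ↔ f.Monic ∧ f.natDegree ≤ n ∧ Irreducible f := by
  simp [irreduciblesUpTo, mem_irreduciblesOfDegree]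
  tauto

theorem card_monicsOfDegree (n : ℕ) :
    (monicsOfDegree F n).card = Fintype.card F ^ n := by
  have e := (monicEquivDegreeLT (R := F) n).trans (degreeLTEquiv F n).toEquiv
  rw [monicsOfDegree, ← Set.ncard_eq_toFinset_card _ (finite_setOf_monic_natDegree_eq F n),
    ← Nat.card_coe_set_eq]
  exact (Nat.card_congr e).trans (by simp)

/-- The degree of a monic polynomial counted by its prime power divisors. -/
theorem natDegree_eq_sum_primePow_dvd {n : ℕ} {f : F[X]} (hf : f.Monic) (hn : f.natDegree = n) :
    n = ∑ P ∈ irreduciblesUpTo F n, ∑ j ∈ Finset.Icc 1 n,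
      open scoped Classical in if P ^ j ∣ f then P.natDegree else 0 := by
  classical
  open UniqueFactorizationMonoid in
  have hf0 : f ≠ 0 := hf.ne_zero
  have hmonic : ∀ P ∈ normalizedFactors f, P.Monic := fun P hP => by
    rw [← normalize_normalized_factor P hP]
    exact monic_normalize (irreducible_of_normalized_factor P hP).ne_zero
  have hprod : (normalizedFactors f).prod = f := by
    rw [prod_normalizedFactors_eq hf0, hf.normalize_eq_self]
  have hdeg : n = ((normalizedFactors f).map natDegree).sum := by
    rw [← natDegree_multiset_prod_of_monic _ hmonic, hprod, hn]
  have hpow : ∀ P : F[X], P.Monic → Irreducible P → ∀ j, P ^ j ∣ f ↔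
      j ≤ (normalizedFactors f).count P := fun P hP hirr j => by
    rw [pow_dvd_iff_le_emultiplicity, emultiplicity_eq_count_normalizedFactors hirr hf0,
      hP.normalize_eq_self, Nat.cast_le]
  have hle : ∀ P, P.Monic → Irreducible P → (normalizedFactors f).count P ≤ n :=
    fun P hP hirr => by
      have := natDegree_le_of_dvd ((hpow P hP hirr _).2 le_rfl) hf0
      rw [natDegree_pow, hn] at this
      exact (Nat.le_mul_of_pos_right _ hirr.natDegree_pos).trans this
  have hinner : ∀ P ∈ irreduciblesUpTo F n, (∑ j ∈ Finset.Icc 1 n,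
      if P ^ j ∣ f then P.natDegree else 0) =
        (normalizedFactors f).count P * P.natDegree := fun P hP => by
    obtain ⟨hP, -, hirr⟩ := mem_irreduciblesUpTo.1 hP
    rw [← Finset.sum_filter, Finset.sum_const, smul_eq_mul]
    congr 1
    have : {j ∈ Finset.Icc 1 n | P ^ j ∣ f} =
        Finset.Icc 1 ((normalizedFactors f).count P) := by
      ext j
      have := hle P hP hirr
      simp only [Finset.mem_filter, Finset.mem_Icc, hpow P hP hirr]
      omega
    rw [this, Nat.card_Icc, Nat.add_sub_cancel]
  rw [Finset.sum_congr rfl hinner]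
  refine (hdeg.trans (Finset.sum_multiset_map_count _ _)).trans ?_
  refine Finset.sum_subset (fun P hP => ?_) fun P _ hP => ?_
  · rw [Multiset.mem_toFinset] at hP
    exact mem_irreduciblesUpTo.2 ⟨hmonic P hP, hn ▸ natDegree_le_of_dvd
      (dvd_of_mem_normalizedFactors hP) hf0, irreducible_of_normalized_factor P hP⟩
  · rw [Multiset.mem_toFinset, ← Multiset.count_eq_zero] at hP
    rw [hP, zero_smul]

/-- The sum of `ψ` over the monic polynomials of degree `n`. -/
noncomputable def monicSum (ψ : F[X] →* ℂ) (n : ℕ) : ℂ := ∑ f ∈ monicsOfDegree F n, ψ f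

open scoped Classical in
/-- The sum of `ψ`, weighted by the von Mangoldt function, over the monic polynomials of
degree `n`. -/
noncomputable def mangoldtSum (ψ : F[X] →* ℂ) (n : ℕ) : ℂ :=
  ∑ P ∈ irreduciblesUpTo F n, ∑ j ∈ Finset.Icc 1 n,
    if P.natDegree * j = n then (P.natDegree : ℂ) * ψ P ^ j else 0

theorem mangoldtSum_eq_of_le (ψ : F[X] →* ℂ) {i n : ℕ} (h : i ≤ n) :
    mangoldtSum ψ i = ∑ P ∈ irreduciblesUpTo F n, ∑ j ∈ Finset.Icc 1 n,
      if P.natDegree * j = i then (P.natDegree : ℂ) * ψ P ^ j else 0 := by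
  classical
  have hsub : irreduciblesUpTo F i ⊆ irreduciblesUpTo F n := fun P hP => by
    rw [mem_irreduciblesUpTo] at hP ⊢
    exact ⟨hP.1, hP.2.1.trans h, hP.2.2⟩
  rw [mangoldtSum, ← Finset.sum_subset hsub]
  · refine Finset.sum_congr rfl fun P hP => Finset.sum_subset
      (Finset.Icc_subset_Icc_right h) fun j hj hj' => if_neg fun hi => hj' ?_
    have hd := (mem_irreduciblesUpTo.1 hP).2.2.natDegree_pos
    rw [Finset.mem_Icc] at hj ⊢
    exact ⟨hj.1, hi ▸ Nat.le_mul_of_pos_left _ hd⟩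
  · intro P hP hP'
    refine Finset.sum_eq_zero fun j hj => if_neg fun hi => hP' ?_
    rw [mem_irreduciblesUpTo] at hP ⊢
    exact ⟨hP.1, hi ▸ Nat.le_mul_of_pos_right _ (Finset.mem_Icc.1 hj).1, hP.2.2⟩

open scoped Classical in
/-- Sums over the monic multiples of a fixed monic polynomial. -/
theorem sum_monicsOfDegree_dvd (ψ : F[X] →* ℂ) {g : F[X]} (hg : g.Monic) (n : ℕ) :
    (∑ f ∈ monicsOfDegree F n, if g ∣ f then ψ f else 0) =
      if g.natDegree ≤ n then ψ g * monicSum ψ (n - g.natDegree) else 0 := by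
  split_ifs with h
  · rw [monicSum, Finset.mul_sum, ← Finset.sum_filter]
    refine (Finset.sum_bij (fun f _ => g * f) ?_ ?_ ?_ ?_).symm
    · intro f hf
      rw [mem_monicsOfDegree] at hf
      rw [Finset.mem_filter, mem_monicsOfDegree, hg.natDegree_mul hf.1, hf.2]
      exact ⟨⟨hg.mul hf.1, by omega⟩, dvd_mul_right _ _⟩
    · intro f _ f' _ hff
      exact mul_left_cancel₀ hg.ne_zero hff
    · intro f hf
      rw [Finset.mem_filter, mem_monicsOfDegree] at hf
      obtain ⟨⟨hf, hfn⟩, k, rfl⟩ := hf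
      have hk : k.Monic := hg.of_mul_monic_left hf
      refine ⟨k, mem_monicsOfDegree.2 ⟨hk, ?_⟩, rfl⟩
      rw [hg.natDegree_mul hk] at hfn
      omega
    · intro f _
      rw [map_mul]
  · refine Finset.sum_eq_zero fun f hf => if_neg fun hd => h ?_
    rw [mem_monicsOfDegree] at hf
    exact hf.2 ▸ natDegree_le_of_dvd hd hf.1.ne_zero

/-- The generating series of `monicSum`. -/
noncomputable def monicSeries (ψ : F[X] →* ℂ) : PowerSeries ℂ := PowerSeries.mk (monicSum ψ)

/-- The generating series of `mangoldtSum`. -/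
noncomputable def mangoldtSeries (ψ : F[X] →* ℂ) : PowerSeries ℂ :=
  PowerSeries.mk (mangoldtSum ψ)

theorem natCast_mul_monicSum (ψ : F[X] →* ℂ) (n : ℕ) :
    n * monicSum ψ n = ∑ i ∈ Finset.range (n + 1), mangoldtSum ψ i * monicSum ψ (n - i) := by
  classical
  have h₁ : n * monicSum ψ n = ∑ P ∈ irreduciblesUpTo F n, ∑ j ∈ Finset.Icc 1 n,
      P.natDegree * ∑ f ∈ monicsOfDegree F n, if P ^ j ∣ f then ψ f else 0 := by
    simp_rw [monicSum, Finset.mul_sum]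
    rw [Finset.sum_congr rfl fun P _ => Finset.sum_comm, Finset.sum_comm]
    refine Finset.sum_congr rfl fun f hf => ?_
    rw [mem_monicsOfDegree] at hf
    conv_lhs => rw [natDegree_eq_sum_primePow_dvd hf.1 hf.2]
    push_cast
    rw [Finset.sum_mul]
    refine Finset.sum_congr rfl fun P _ => ?_
    rw [Finset.sum_mul]
    refine Finset.sum_congr rfl fun j _ => ?_
    split_ifs <;> simp
  have h₂ : ∀ i ∈ Finset.range (n + 1), mangoldtSum ψ i * monicSum ψ (n - i) =
      ∑ P ∈ irreduciblesUpTo F n, ∑ j ∈ Finset.Icc 1 n, if P.natDegree * j = i then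
        (P.natDegree : ℂ) * ψ P ^ j * monicSum ψ (n - i) else 0 := fun i hi => by
    rw [mangoldtSum_eq_of_le ψ (Nat.lt_succ_iff.1 (Finset.mem_range.1 hi)), Finset.sum_mul]
    refine Finset.sum_congr rfl fun P _ => ?_
    rw [Finset.sum_mul]
    refine Finset.sum_congr rfl fun j _ => ?_
    rw [ite_mul, zero_mul]
  rw [h₁, Finset.sum_congr rfl h₂, Finset.sum_comm (s := Finset.range (n + 1))]
  refine Finset.sum_congr rfl fun P hP => ?_
  refine Eq.trans (Finset.sum_congr rfl fun j _ => ?_) Finset.sum_comm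
  have hP' := (mem_irreduciblesUpTo.1 hP).1
  rw [sum_monicsOfDegree_dvd ψ (hP'.pow j), Finset.sum_ite_eq, natDegree_pow, map_pow,
    mul_comm j, mul_ite, mul_zero]
  simp only [Finset.mem_range, Nat.lt_succ_iff, mul_assoc]

/-- The logarithmic derivative of the `L`-series. -/
theorem X_mul_derivative_monicSeries (ψ : F[X] →* ℂ) :
    PowerSeries.X * PowerSeries.derivative ℂ (monicSeries ψ) =
      mangoldtSeries ψ * monicSeries ψ := by
  ext n
  rw [PowerSeries.coeff_mul _ (mangoldtSeries ψ), Finset.Nat.sum_antidiagonal_eq_sum_range_succ_mk]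
  simp only [mangoldtSeries, monicSeries, PowerSeries.coeff_mk]
  rw [← natCast_mul_monicSum]
  cases n with
  | zero => simp
  | succ n =>
    rw [PowerSeries.coeff_succ_X_mul, PowerSeries.coeff_derivative, PowerSeries.coeff_mk]
    push_cast
    ring

end MonicSums

section LogDerivative

theorem PowerSeries.coeff_X_mul_derivative {R : Type*} [CommRing R] (f : PowerSeries R) (n : ℕ) :
    PowerSeries.coeff n (PowerSeries.X * PowerSeries.derivative R f) =
      n * PowerSeries.coeff n f := by
  cases n with
  | zero => simp
  | succ n =>
    rw [PowerSeries.coeff_succ_X_mul, PowerSeries.coeff_derivative]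
    push_cast
    ring

/-- If the logarithmic derivative of a polynomial has nonnegative coefficients, it has
finitely many coefficients. -/
theorem eventually_eq_zero_of_logDeriv_nonneg {D : ℂ[X]} {c : ℕ → ℝ} (hc : ∀ n, 0 ≤ c n)
    (hc₀ : c 0 = 0) (hD₀ : D.coeff 0 = 1)
    (h : PowerSeries.X * PowerSeries.derivative ℂ (D : PowerSeries ℂ) =
      PowerSeries.mk (fun n => (c n : ℂ)) * (D : PowerSeries ℂ)) :
    ∀ n, D.natDegree < n → c n = 0 := by
  open scoped ComplexOrder in
  have key : ∀ n : ℕ, n * D.coeff n =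
      ∑ i ∈ Finset.range n, (c (i + 1) : ℂ) * D.coeff (n - (i + 1)) := fun n => by
    have := congrArg (PowerSeries.coeff n) h
    rw [PowerSeries.coeff_X_mul_derivative, PowerSeries.coeff_mul,
      Finset.Nat.sum_antidiagonal_eq_sum_range_succ_mk, Finset.sum_range_succ'] at this
    simpa [hc₀] using this
  have hpos : ∀ n, 0 ≤ D.coeff n := fun n => by
    induction n using Nat.strong_induction_on with
    | _ n ih =>
      rcases Nat.eq_zero_or_pos n with rfl | hn
      · rw [hD₀]; exact zero_le_one
      · have h0 : 0 ≤ (n : ℂ) * D.coeff n := by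
          rw [key]
          exact Finset.sum_nonneg fun i hi => mul_nonneg (by exact_mod_cast hc _)
            (ih _ (by omega))
        have hn' : (0 : ℂ) < n := by exact_mod_cast hn
        exact le_of_mul_le_mul_left (by simpa using h0) hn'
  intro n hn
  have h0 := key n
  rw [coeff_eq_zero_of_natDegree_lt hn, mul_zero] at h0
  have hmem : n - 1 ∈ Finset.range n := by rw [Finset.mem_range]; omega
  have := (Finset.sum_eq_zero_iff_of_nonneg fun i _ =>
    mul_nonneg (by exact_mod_cast hc (i + 1)) (hpos _)).1 h0.symm _ hmem
  rw [Nat.sub_add_cancel (by omega), Nat.sub_self, hD₀, mul_one] at this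
  exact_mod_cast this

open Filter Topology in
/-- If all roots of a polynomial have absolute value greater than `1 / q`, the coefficients of
its logarithmic derivative grow slower than `q ^ n`. -/
theorem tendsto_coeff_logDeriv {L : ℂ[X]} (hL : L ≠ 0) {q : ℝ} (hq : 0 < q)
    (hroot : ∀ z, L.eval z = 0 → 1 < q * ‖z‖) {G : PowerSeries ℂ}
    (hG : PowerSeries.X * PowerSeries.derivative ℂ (L : PowerSeries ℂ) = G * (L : PowerSeries ℂ)) :
    Tendsto (fun n => ‖PowerSeries.coeff n G‖ / q ^ n) atTop (𝓝 0) := by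
  have main : ∀ s : Multiset ℂ, (∀ z ∈ s, 1 < q * ‖z‖) → ∃ H : PowerSeries ℂ,
      PowerSeries.X * PowerSeries.derivative ℂ
        (((s.map fun z => X - C z).prod : ℂ[X]) : PowerSeries ℂ) =
        H * (((s.map fun z => X - C z).prod : ℂ[X]) : PowerSeries ℂ) ∧
      Tendsto (fun n => ‖PowerSeries.coeff n H‖ / q ^ n) atTop (𝓝 0) := fun s => by
    induction s using Multiset.induction_on with
    | empty => exact fun _ => ⟨0, by simp, by simp⟩
    | cons z s ih =>
      intro hs
      obtain ⟨H, h₁, h₂⟩ := ih fun w hw => hs w (Multiset.mem_cons_of_mem hw)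
      have hz := hs z (Multiset.mem_cons_self z s)
      have hz0 : z ≠ 0 := by rintro rfl; simp at hz; linarith
      let K : PowerSeries ℂ := PowerSeries.mk fun n => if n = 0 then 0 else -(z⁻¹) ^ n
      have hK : K * ((X - C z : ℂ[X]) : PowerSeries ℂ) = PowerSeries.X := by
        rw [Polynomial.coe_sub, Polynomial.coe_X, Polynomial.coe_C, mul_sub]
        ext n
        rw [map_sub, PowerSeries.coeff_mul_C]
        cases n with
        | zero => simp [K, PowerSeries.coeff_X]
        | succ n =>
          rw [PowerSeries.coeff_succ_mul_X, PowerSeries.coeff_X]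
          simp only [K, PowerSeries.coeff_mk, Nat.succ_ne_zero, if_false, Nat.add_eq_right]
          split_ifs with h
          · simp [h, hz0]
          · rw [pow_succ]; field_simp; simp
      refine ⟨H + K, ?_, ?_⟩
      · rw [Multiset.map_cons, Multiset.prod_cons, Polynomial.coe_mul, Derivation.leibniz]
        have hd : PowerSeries.derivative ℂ ((X - C z : ℂ[X]) : PowerSeries ℂ) = 1 := by
          rw [PowerSeries.derivative_coe]; simp
        rw [hd, smul_eq_mul, smul_eq_mul]
        linear_combination ((X - C z : ℂ[X]) : PowerSeries ℂ) * h₁ -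
          (((s.map fun z => X - C z).prod : ℂ[X]) : PowerSeries ℂ) * hK
      · have hK' : Tendsto (fun n => ‖PowerSeries.coeff n K‖ / q ^ n) atTop (𝓝 0) := by
          have hlt : (q * ‖z‖)⁻¹ < 1 := inv_lt_one_of_one_lt₀ hz
          refine squeeze_zero (fun n => by positivity) (fun n => ?_)
            (tendsto_pow_atTop_nhds_zero_of_lt_one (by positivity) hlt)
          simp only [K, PowerSeries.coeff_mk]
          split_ifs with h
          · simp [h]
          · rw [norm_neg, norm_pow, norm_inv, mul_inv, mul_pow, inv_pow, inv_pow]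
            exact le_of_eq (by ring)
        refine squeeze_zero (fun n => by positivity) (fun n => ?_)
          (by simpa using h₂.add hK')
        rw [map_add, ← add_div]
        gcongr
        exact norm_add_le _ _
  obtain ⟨H, h₁, h₂⟩ := main L.roots fun z hz => hroot z (isRoot_of_mem_roots hz)
  have hsplit : L = C L.leadingCoeff * (L.roots.map fun z => X - C z).prod :=
    (IsAlgClosed.splits L).eq_prod_roots
  have hL' : (L : PowerSeries ℂ) ≠ 0 := fun h => hL (Polynomial.coe_eq_zero_iff.1 h)
  have hHG : G = H := by
    refine mul_right_cancel₀ hL' ?_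
    rw [← hG, hsplit, Polynomial.coe_mul, Polynomial.coe_C, Derivation.leibniz,
      PowerSeries.derivative_C, smul_zero, add_zero, smul_eq_mul]
    linear_combination PowerSeries.C L.leadingCoeff * h₁
  rwa [hHG]

end LogDerivative

section LFunctions

variable {F : Type*} [Field F] [Fintype F]

theorem monicsOfDegree_zero : monicsOfDegree F 0 = {1} := by
  ext f
  rw [mem_monicsOfDegree, Finset.mem_singleton]
  exact ⟨fun h => h.1.natDegree_eq_zero.mp h.2, by rintro rfl; simp⟩

theorem one_sub_mul_mangoldtSeries_one :
    (1 - PowerSeries.C (Fintype.card F : ℂ) * PowerSeries.X) *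
      mangoldtSeries (1 : F[X] →* ℂ) =
      PowerSeries.C (Fintype.card F : ℂ) * PowerSeries.X := by
  have hS : (1 - PowerSeries.C (Fintype.card F : ℂ) * PowerSeries.X) *
      monicSeries (1 : F[X] →* ℂ) = 1 := by
    ext n
    rw [sub_mul, one_mul, mul_assoc, map_sub, PowerSeries.coeff_C_mul]
    rcases n with _ | n
    · simp [monicSeries, monicSum, card_monicsOfDegree]
    · rw [PowerSeries.coeff_succ_X_mul]
      simp [monicSeries, monicSum, card_monicsOfDegree, PowerSeries.coeff_one, pow_succ']
  have hd := congrArg (PowerSeries.derivative ℂ) hS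
  have h := X_mul_derivative_monicSeries (1 : F[X] →* ℂ)
  simp only [Derivation.leibniz, map_sub, Derivation.map_one_eq_zero, smul_eq_mul,
    PowerSeries.derivative_C, PowerSeries.derivative_X] at hd
  linear_combination (-(1 - PowerSeries.C (Fintype.card F : ℂ) * PowerSeries.X) *
    mangoldtSeries (1 : F[X] →* ℂ) + PowerSeries.C (Fintype.card F : ℂ) * PowerSeries.X) * hS +
    (1 - PowerSeries.C (Fintype.card F : ℂ) * PowerSeries.X) * (PowerSeries.X * hd -
    (1 - PowerSeries.C (Fintype.card F : ℂ) * PowerSeries.X) * h)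

theorem mangoldtSum_zero (ψ : F[X] →* ℂ) : mangoldtSum ψ 0 = 0 := by
  simp [mangoldtSum]

theorem mangoldtSum_one_eq {n : ℕ} (hn : n ≠ 0) :
    mangoldtSum (1 : F[X] →* ℂ) n = (Fintype.card F : ℂ) ^ n := by
  have key (m : ℕ) := congrArg (PowerSeries.coeff (m + 1))
    (one_sub_mul_mangoldtSeries_one (F := F))
  simp only [sub_mul, one_mul, mul_assoc, map_sub, PowerSeries.coeff_C_mul,
    PowerSeries.coeff_succ_X_mul, mangoldtSeries, PowerSeries.coeff_mk,
    PowerSeries.coeff_X] at key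
  obtain ⟨m, rfl⟩ := Nat.exists_eq_succ_of_ne_zero hn
  induction m with
  | zero => simpa [mangoldtSum_zero] using key 0
  | succ k ih =>
    have := key (k + 1)
    rw [ih (by simp)] at this
    simp only [Nat.succ_eq_add_one] at *
    simp at this
    rw [pow_succ' _ (k + 1), sub_eq_zero.mp this]

/-- The `L`-series of a bounded completely multiplicative function, when it is a polynomial, has
no zero in the closed disc of radius `1 / q`. -/
theorem one_lt_card_mul_norm_of_monicSeries_eq {ψ : F[X] →* ℂ} (hψ : ∀ f, ‖ψ f‖ ≤ 1) {L : ℂ[X]}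
    (hL : monicSeries ψ = (L : PowerSeries ℂ)) {α : ℂ} (hα : L.eval α = 0) :
    1 < (Fintype.card F : ℝ) * ‖α‖ := by
  by_contra! hle
  set q : ℂ := (Fintype.card F : ℂ) with hq
  have hq0 : q ≠ 0 := by simp [hq]
  set w : ℂ := q * α with hw
  have hw1 : ‖w‖ ≤ 1 := by simpa [hw, hq] using hle
  have hL0 : L.coeff 0 = 1 := by
    have := congrArg (PowerSeries.coeff 0) hL
    rw [Polynomial.coeff_coe] at this
    rw [← this]
    simp [monicSeries, monicSum, monicsOfDegree_zero]
  have hdvd : (1 - C q * X) ∣ L.comp (C w * X) := by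
    have h1 : (X - C q⁻¹) ∣ L.comp (C w * X) := by
      rw [dvd_iff_isRoot, IsRoot.def, eval_comp]
      simp only [eval_mul, eval_C, eval_X]
      rwa [show w * q⁻¹ = α by rw [hw]; field_simp]
    refine dvd_trans ⟨C (-q⁻¹), ?_⟩ h1
    have : (C q : ℂ[X]) * C q⁻¹ = 1 := by rw [← C_mul, mul_inv_cancel₀ hq0, C_1]
    simp only [C_neg]
    linear_combination (-X) * this
  obtain ⟨A, hA⟩ := hdvd
  have hA0 : A.coeff 0 = 1 := by
    have := congrArg (fun p => p.coeff 0) hA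
    simp only [mul_coeff_zero, comp_C_mul_X_coeff] at this
    simpa [hL0] using this.symm
  set z : ℕ → ℂ := fun n => mangoldtSum (1 : F[X] →* ℂ) n + w ^ n * mangoldtSum ψ n with hz
  have hresc : PowerSeries.rescale w (L : PowerSeries ℂ) =
      (1 - PowerSeries.C q * PowerSeries.X) * (A : PowerSeries ℂ) := by
    have : ((1 - C q * X : ℂ[X]) : PowerSeries ℂ) = 1 - PowerSeries.C q * PowerSeries.X := by
      simp
    rw [← this, ← Polynomial.coe_mul, ← hA]
    ext n
    rw [PowerSeries.coeff_rescale, Polynomial.coeff_coe, Polynomial.coeff_coe, comp_C_mul_X_coeff,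
      mul_comm]
  have hdA : PowerSeries.X * PowerSeries.derivative ℂ (A : PowerSeries ℂ) =
      PowerSeries.mk z * (A : PowerSeries ℂ) := by
    have h1 : PowerSeries.X * PowerSeries.derivative ℂ (PowerSeries.rescale w (L : PowerSeries ℂ))
        = PowerSeries.rescale w (mangoldtSeries ψ) * PowerSeries.rescale w (L : PowerSeries ℂ) := by
      rw [← map_mul, ← hL, ← X_mul_derivative_monicSeries ψ]
      ext n
      rw [PowerSeries.coeff_X_mul_derivative, PowerSeries.coeff_rescale,
        PowerSeries.coeff_rescale, PowerSeries.coeff_X_mul_derivative]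
      ring
    have h2 : PowerSeries.mk z =
        mangoldtSeries (1 : F[X] →* ℂ) + PowerSeries.rescale w (mangoldtSeries ψ) := by
      ext n
      simp [hz, mangoldtSeries, PowerSeries.coeff_rescale]
    have h3 := one_sub_mul_mangoldtSeries_one (F := F)
    rw [hresc] at h1
    simp only [Derivation.leibniz, map_sub, Derivation.map_one_eq_zero, smul_eq_mul,
      PowerSeries.derivative_C, PowerSeries.derivative_X] at h1
    have hne : (1 - PowerSeries.C q * PowerSeries.X : PowerSeries ℂ) ≠ 0 := by
      intro h0
      have := congrArg (PowerSeries.coeff 0) h0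
      simp at this
    apply mul_left_cancel₀ hne
    rw [h2]
    rw [← hq] at h3
    linear_combination h1 - (A : PowerSeries ℂ) * h3
  set B : ℂ[X] := A.map (starRingEnd ℂ) with hB
  have hdB : PowerSeries.X * PowerSeries.derivative ℂ (B : PowerSeries ℂ) =
      PowerSeries.mk (fun n => starRingEnd ℂ (z n)) * (B : PowerSeries ℂ) := by
    have e1 : (B : PowerSeries ℂ) = PowerSeries.map (starRingEnd ℂ) (A : PowerSeries ℂ) := by
      ext n; simp [hB]
    have e2 : PowerSeries.mk (fun n => starRingEnd ℂ (z n)) =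
        PowerSeries.map (starRingEnd ℂ) (PowerSeries.mk z) := by
      ext n; simp
    rw [e2, e1, ← map_mul, ← hdA]
    ext n
    rw [PowerSeries.coeff_X_mul_derivative, PowerSeries.coeff_map, PowerSeries.coeff_map,
      PowerSeries.coeff_X_mul_derivative]
    simp
  have hterm (n : ℕ) (P : F[X]) (j : ℕ) :
      0 ≤ (P.natDegree : ℝ) * (1 + (w ^ n * ψ P ^ j).re) := by
    have : ‖w ^ n * ψ P ^ j‖ ≤ 1 := by
      rw [norm_mul, norm_pow, norm_pow]
      exact mul_le_one₀ (pow_le_one₀ (norm_nonneg _) hw1) (by positivity)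
        (pow_le_one₀ (norm_nonneg _) (hψ P))
    have := (abs_le.mp ((Complex.abs_re_le_norm _).trans this)).1
    exact mul_nonneg (Nat.cast_nonneg _) (by linarith)
  have hre (n : ℕ) : (z n).re = ∑ P ∈ irreduciblesUpTo F n, ∑ j ∈ Finset.Icc 1 n,
      if P.natDegree * j = n then (P.natDegree : ℝ) * (1 + (w ^ n * ψ P ^ j).re) else 0 := by
    simp only [hz, mangoldtSum, Finset.mul_sum, ← Finset.sum_add_distrib, Complex.re_sum]
    refine Finset.sum_congr rfl fun P _ => Finset.sum_congr rfl fun j _ => ?_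
    split_ifs
    · have : (P.natDegree : ℂ) * (1 : F[X] →* ℂ) P ^ j + w ^ n * ((P.natDegree : ℂ) * ψ P ^ j) =
        ((P.natDegree : ℝ) : ℂ) * (1 + w ^ n * ψ P ^ j) := by simp; ring
      rw [this, Complex.re_ofReal_mul, Complex.add_re, Complex.one_re]
    · simp
  have hnn (n : ℕ) (P : F[X]) (j : ℕ) : 0 ≤
      if P.natDegree * j = n then (P.natDegree : ℝ) * (1 + (w ^ n * ψ P ^ j).re) else 0 := by
    split_ifs
    · exact hterm n P j
    · exact le_rfl
  have hzero := eventually_eq_zero_of_logDeriv_nonneg (D := A * B) (c := fun n => 2 * (z n).re)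
    (fun n => by
      rw [hre n]
      exact mul_nonneg zero_le_two
        (Finset.sum_nonneg fun P _ => Finset.sum_nonneg fun j _ => hnn n P j))
    (by simp [hz, mangoldtSum_zero]) (by simp [mul_coeff_zero, hB, hA0])
    (by
      have e : PowerSeries.mk (fun n => ((2 * (z n).re : ℝ) : ℂ)) =
          PowerSeries.mk z + PowerSeries.mk (fun n => starRingEnd ℂ (z n)) := by
        ext n
        simp only [PowerSeries.coeff_mk, map_add, Complex.add_conj]
      rw [e, Polynomial.coe_mul, Derivation.leibniz, smul_eq_mul, smul_eq_mul]
      linear_combination (A : PowerSeries ℂ) * hdB + (B : PowerSeries ℂ) * hdA)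
  have hX (n : ℕ) (hn : (A * B).natDegree < n) : ((w * ψ X) ^ n).re = -1 := by
    have h0 : (z n).re = 0 := by simpa using hzero n hn
    rw [hre n, Finset.sum_eq_zero_iff_of_nonneg
      (fun P _ => Finset.sum_nonneg fun j _ => hnn n P j)] at h0
    have h1 := h0 X (mem_irreduciblesUpTo.mpr ⟨monic_X, by simp; omega, irreducible_X⟩)
    rw [Finset.sum_eq_zero_iff_of_nonneg (fun j _ => hnn n X j)] at h1
    have h2 := h1 n (Finset.mem_Icc.mpr ⟨by omega, le_rfl⟩)
    simp [← mul_pow] at h2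
    linarith
  have hneg (n : ℕ) (hn : (A * B).natDegree < n) : (w * ψ X) ^ n = -1 := by
    have h1 := hX n hn
    have h2 : ‖(w * ψ X) ^ n‖ ≤ 1 := by
      rw [norm_pow, norm_mul]
      exact pow_le_one₀ (by positivity) (mul_le_one₀ hw1 (norm_nonneg _) (hψ X))
    have h3 : Complex.normSq ((w * ψ X) ^ n) ≤ 1 := by
      rw [Complex.normSq_eq_norm_sq]
      exact pow_le_one₀ (norm_nonneg _) h2
    rw [Complex.normSq_apply, h1] at h3
    refine Complex.ext (by simp [h1]) ?_
    simp only [Complex.neg_im, Complex.one_im, neg_zero]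
    nlinarith
  have ha := hneg ((A * B).natDegree + 1) (by omega)
  have hb := hneg (((A * B).natDegree + 1) * 2) (by omega)
  rw [pow_mul, ha] at hb
  norm_num at hb

end LFunctions

section DirichletPolynomial

variable {F : Type*} [Field F]

/-- The completely multiplicative function on polynomials induced by a character modulo `a`. -/
noncomputable def charHom {a : F[X]} (χ : MulChar (AdjoinRoot a) ℂ) : F[X] →* ℂ :=
  χ.toMonoidHom.comp (AdjoinRoot.mk a : F[X] →* AdjoinRoot a)

theorem charHom_apply {a : F[X]} (χ : MulChar (AdjoinRoot a) ℂ) (f : F[X]) :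
    charHom χ f = χ (AdjoinRoot.mk a f) := rfl

variable [Fintype F]

theorem finite_adjoinRoot {a : F[X]} (ha : a ≠ 0) : Finite (AdjoinRoot a) :=
  have := (AdjoinRoot.powerBasis ha).finite
  Module.finite_of_finite F

theorem norm_charHom_le_one {a : F[X]} (ha : a ≠ 0) (χ : MulChar (AdjoinRoot a) ℂ) (f : F[X]) :
    ‖charHom χ f‖ ≤ 1 := by
  have := finite_adjoinRoot ha
  rw [charHom_apply]
  by_cases h : IsUnit (AdjoinRoot.mk a f)
  · obtain ⟨u, hu⟩ := h
    rw [← hu]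
    obtain ⟨k, hk, hk1⟩ := (isOfFinOrder_iff_pow_eq_one (x := u)).mp (isOfFinOrder_of_finite u)
    refine (Complex.norm_eq_one_of_pow_eq_one (n := k) ?_ hk.ne').le
    rw [← map_pow, ← Units.val_pow_eq_pow_val, hk1, Units.val_one, map_one]
  · rw [χ.map_nonunit h, norm_zero]
    exact zero_le_one

theorem monicSum_charHom_eq_zero {a : F[X]} (ha : 0 < a.natDegree)
    {χ : MulChar (AdjoinRoot a) ℂ} (hχ : χ ≠ 1) {n : ℕ} (hn : a.natDegree ≤ n) :
    monicSum (charHom χ) n = 0 := by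
  have ha0 : a ≠ 0 := by rintro rfl; simp at ha
  have := finite_adjoinRoot ha0
  have := Fintype.ofFinite (AdjoinRoot a)
  have hshift (r : AdjoinRoot a) :
      monicSum (charHom χ) n = ∑ f ∈ monicsOfDegree F n, χ (AdjoinRoot.mk a f + r) := by
    obtain ⟨g, rfl⟩ := AdjoinRoot.mk_surjective r
    have hg : (g % a).natDegree < n := (natDegree_mod_lt g ha.ne').trans_le hn
    have hmk : AdjoinRoot.mk a (g % a) = AdjoinRoot.mk a g := by
      rw [AdjoinRoot.mk_eq_mk]
      exact ⟨-(g / a), by linear_combination EuclideanDomain.div_add_mod g a⟩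
    have hmem {e : F[X]} (he : e.natDegree < n) {f : F[X]} (hf : f ∈ monicsOfDegree F n) :
        f + e ∈ monicsOfDegree F n := by
      rw [mem_monicsOfDegree] at hf ⊢
      have hd : e.natDegree < f.natDegree := by omega
      exact ⟨hf.1.add_of_left (degree_lt_degree hd),
        (natDegree_add_eq_left_of_natDegree_lt hd).trans hf.2⟩
    symm
    refine Finset.sum_bij' (fun f _ => f + g % a) (fun f _ => f + -(g % a))
      (fun f hf => hmem hg hf) (fun f hf => hmem (by rwa [natDegree_neg]) hf)
      (fun f _ => by ring) (fun f _ => by ring) (fun f _ => ?_)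
    rw [charHom_apply, map_add (AdjoinRoot.mk a), hmk]
  have hsum : ∑ _r : AdjoinRoot a, monicSum (charHom χ) n = 0 := by
    rw [Finset.sum_congr rfl fun r _ => hshift r, Finset.sum_comm]
    refine Finset.sum_eq_zero fun f _ => ?_
    exact (Equiv.sum_comp (Equiv.addLeft (AdjoinRoot.mk a f)) χ).trans
      (MulChar.sum_eq_zero_of_ne_one hχ)
  rw [Finset.sum_const, nsmul_eq_mul, mul_eq_zero] at hsum
  refine hsum.resolve_left ?_
  simp

theorem tendsto_norm_mangoldtSum_charHom {a : F[X]} (ha : 0 < a.natDegree)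
    {χ : MulChar (AdjoinRoot a) ℂ} (hχ : χ ≠ 1) :
    Filter.Tendsto (fun n => ‖mangoldtSum (charHom χ) n‖ / (Fintype.card F : ℝ) ^ n) Filter.atTop
      (nhds 0) := by
  have ha0 : a ≠ 0 := by rintro rfl; simp at ha
  set L : ℂ[X] := PowerSeries.trunc a.natDegree (monicSeries (charHom χ)) with hLdef
  have hL : monicSeries (charHom χ) = (L : PowerSeries ℂ) := by
    ext n
    rw [Polynomial.coeff_coe, hLdef, PowerSeries.coeff_trunc]
    split_ifs with h
    · rfl
    · simpa [monicSeries] using monicSum_charHom_eq_zero ha hχ (not_lt.mp h)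
  have hL0 : L ≠ 0 := by
    intro h0
    have := congrArg (PowerSeries.coeff 0) hL
    simp [h0, monicSeries, monicSum, monicsOfDegree_zero] at this
  have h := tendsto_coeff_logDeriv hL0 (q := Fintype.card F) (by simp [Fintype.card_pos])
    (fun z hz => one_lt_card_mul_norm_of_monicSeries_eq (norm_charHom_le_one ha0 χ) hL hz)
    (G := mangoldtSeries (charHom χ)) (by rw [← hL]; exact X_mul_derivative_monicSeries _)
  simpa [mangoldtSeries] using h

/-- In prime degree, the von Mangoldt sum is the sum over irreducible polynomials up to
the contribution of the linear ones. -/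
theorem norm_mangoldtSum_sub_le {ψ : F[X] →* ℂ} (hψ : ∀ f, ‖ψ f‖ ≤ 1) {n : ℕ} (hn : n.Prime) :
    ‖mangoldtSum ψ n - n * ∑ P ∈ irreduciblesOfDegree F n, ψ P‖ ≤ Fintype.card F := by
  classical
  have hterm (P : F[X]) (hP : P ∈ irreduciblesUpTo F n) :
      (∑ j ∈ Finset.Icc 1 n, if P.natDegree * j = n then (P.natDegree : ℂ) * ψ P ^ j else 0) =
        (if P.natDegree = n then (n : ℂ) * ψ P else 0) +
        (if P.natDegree = 1 then ψ P ^ n else 0) := by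
    have hn1 := hn.one_lt
    by_cases h1 : P.natDegree = 1
    · rw [if_neg (by omega), if_pos h1, zero_add, Finset.sum_eq_single n]
      · simp [h1]
      · intro j _ hj; rw [if_neg (by simpa [h1])]
      · intro h; exact absurd (Finset.mem_Icc.mpr ⟨hn1.le, le_rfl⟩) h
    · by_cases h2 : P.natDegree = n
      · rw [if_pos h2, if_neg h1, add_zero, Finset.sum_eq_single 1]
        · simp [h2]
        · intro j _ hj
          rw [if_neg]
          rw [h2]
          intro h
          exact hj (Nat.eq_of_mul_eq_mul_left hn.pos (by simpa using h))
        · intro h; exact absurd (Finset.mem_Icc.mpr ⟨le_rfl, hn1.le⟩) h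
      · rw [if_neg h2, if_neg h1, add_zero]
        refine Finset.sum_eq_zero fun j _ => if_neg fun h => ?_
        rcases (Nat.dvd_prime hn).mp ⟨j, h.symm⟩ with h | h
        · exact h1 h
        · exact h2 h
  have h1 : mangoldtSum ψ n = n * ∑ P ∈ irreduciblesOfDegree F n, ψ P +
      ∑ P ∈ irreduciblesUpTo F n with P.natDegree = 1, ψ P ^ n := by
    rw [mangoldtSum, Finset.sum_congr rfl hterm, Finset.sum_add_distrib, ← Finset.sum_filter,
      ← Finset.sum_filter, Finset.mul_sum]
    congr 1
    refine Finset.sum_congr ?_ fun _ _ => rfl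
    ext P
    simp only [Finset.mem_filter, mem_irreduciblesUpTo, mem_irreduciblesOfDegree]
    constructor
    · rintro ⟨⟨h1, _, h2⟩, h3⟩; exact ⟨h1, h3, h2⟩
    · rintro ⟨h1, h2, h3⟩; exact ⟨⟨h1, h2.le, h3⟩, h2⟩
  rw [h1, add_sub_cancel_left]
  refine (norm_sum_le_of_le _ (fun P _ => ?_) : _ ≤ ∑ P ∈ irreduciblesUpTo F n with
    P.natDegree = 1, (1 : ℝ)).trans ?_
  · rw [norm_pow]; exact pow_le_one₀ (norm_nonneg _) (hψ P)
  · rw [Finset.sum_const, nsmul_eq_mul, mul_one, Nat.cast_le]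
    calc _ ≤ (monicsOfDegree F 1).card := by
          refine Finset.card_le_card fun P hP => ?_
          simp only [Finset.mem_filter, mem_irreduciblesUpTo] at hP
          exact mem_monicsOfDegree.mpr ⟨hP.1.1, hP.2⟩
      _ = _ := by rw [card_monicsOfDegree, pow_one]

theorem sum_mulChar_eq_zero {R : Type*} [CommRing R] [Finite R] [Fintype (MulChar R ℂ)] {r : R}
    (hr : r ≠ 1) : ∑ χ : MulChar R ℂ, χ r = 0 := by
  have : NeZero (Monoid.exponent Rˣ : ℂ) := ⟨by
    exact_mod_cast Monoid.exponent_ne_zero_of_finite⟩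
  obtain ⟨χ, hχ⟩ := MulChar.exists_apply_ne_one_of_hasEnoughRootsOfUnity R ℂ hr
  refine eq_zero_of_mul_eq_self_left hχ ?_
  simp only [Finset.mul_sum, ← MulChar.mul_apply]
  exact Fintype.sum_bijective _ (Group.mulLeft_bijective χ) _ _ fun χ' ↦ rfl

/-- Dirichlet's theorem on primes in arithmetic progressions for polynomials over a finite field,
in every large prime degree. -/
theorem exists_irreducible_dvd_sub {a b : F[X]} (ha : 0 < a.natDegree) (hab : IsCoprime a b) :
    ∃ n₀ : ℕ, ∀ n, n₀ ≤ n → n.Prime →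
      ∃ P : F[X], P.Monic ∧ Irreducible P ∧ P.natDegree = n ∧ a ∣ P - b := by
  classical
  have ha0 : a ≠ 0 := by rintro rfl; simp at ha
  have := finite_adjoinRoot ha0
  have := Fintype.ofFinite (MulChar (AdjoinRoot a) ℂ)
  obtain ⟨s, t, hst⟩ := hab
  set β := AdjoinRoot.mk a t with hβ
  have hβb : β * AdjoinRoot.mk a b = 1 := by
    rw [hβ, ← map_mul, ← map_one (AdjoinRoot.mk a), AdjoinRoot.mk_eq_mk]
    exact ⟨-s, by linear_combination hst⟩
  set q : ℝ := (Fintype.card F : ℝ) with hq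
  have hq1 : 1 < q := by rw [hq]; exact_mod_cast Fintype.one_lt_card
  have hlim : Filter.Tendsto (fun n => (∑ χ ∈ Finset.univ.erase (1 : MulChar (AdjoinRoot a) ℂ),
      (‖mangoldtSum (charHom χ) n‖ / q ^ n + q * q⁻¹ ^ n)) + q * q⁻¹ ^ n)
      Filter.atTop (nhds 0) := by
    have hg : Filter.Tendsto (fun n : ℕ => q * q⁻¹ ^ n) Filter.atTop (nhds 0) := by
      simpa using (tendsto_pow_atTop_nhds_zero_of_lt_one (r := q⁻¹) (by positivity)
        (inv_lt_one_of_one_lt₀ hq1)).const_mul q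
    have hs := tendsto_finsetSum (Finset.univ.erase (1 : MulChar (AdjoinRoot a) ℂ))
      fun χ hχ => (tendsto_norm_mangoldtSum_charHom ha (Finset.ne_of_mem_erase hχ)).add hg
    simpa using hs.add hg
  obtain ⟨n₁, hn₁⟩ := Filter.eventually_atTop.mp (hlim.eventually_lt_const zero_lt_one)
  refine ⟨max n₁ (a.natDegree + 1), fun n hn hp => ?_⟩
  have hlt := hn₁ n (le_of_max_le_left hn)
  have hna : a.natDegree < n := le_of_max_le_right hn
  by_contra! hno
  have hzero : ∑ χ : MulChar (AdjoinRoot a) ℂ,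
      χ β * (n * ∑ P ∈ irreduciblesOfDegree F n, charHom χ P) = 0 := by
    simp_rw [mul_left_comm _ (n : ℂ), Finset.mul_sum]
    rw [Finset.sum_comm]
    refine Finset.sum_eq_zero fun P hP => ?_
    rw [← Finset.mul_sum]
    simp_rw [charHom_apply, ← map_mul]
    rw [sum_mulChar_eq_zero, mul_zero]
    intro h1
    rw [mem_irreduciblesOfDegree] at hP
    refine hno P hP.1 hP.2.2 hP.2.1 (AdjoinRoot.mk_eq_mk.mp ?_)
    linear_combination AdjoinRoot.mk a b * h1 - AdjoinRoot.mk a P * hβb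
  have hunit (P : F[X]) (hP : P ∈ irreduciblesOfDegree F n) : charHom (a := a) 1 P = 1 := by
    rw [mem_irreduciblesOfDegree] at hP
    have hcop : IsCoprime P a := (EuclideanDomain.dvd_or_coprime P a hP.2.2).resolve_left fun h =>
      absurd (natDegree_le_of_dvd h ha0) (by omega)
    obtain ⟨u, v, huv⟩ := hcop
    rw [charHom_apply, MulChar.one_apply]
    refine IsUnit.of_mul_eq_one (AdjoinRoot.mk a u) ?_
    rw [← map_mul, ← map_one (AdjoinRoot.mk a), AdjoinRoot.mk_eq_mk]
    exact ⟨-v, by linear_combination huv⟩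
  have hbound (χ : MulChar (AdjoinRoot a) ℂ) : ‖χ β‖ ≤ 1 := norm_charHom_le_one ha0 χ t
  have hprinc : q ^ n - q ≤
      ‖(1 : MulChar (AdjoinRoot a) ℂ) β * (n * ∑ P ∈ irreduciblesOfDegree F n,
        charHom (1 : MulChar (AdjoinRoot a) ℂ) P)‖ := by
    have hβ1 : (1 : MulChar (AdjoinRoot a) ℂ) β = 1 :=
      MulChar.one_apply (IsUnit.of_mul_eq_one _ hβb)
    rw [hβ1, one_mul, Finset.sum_congr rfl hunit]
    have := norm_mangoldtSum_sub_le (F := F) (ψ := 1) (fun _ => by simp) hp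
    rw [mangoldtSum_one_eq hp.ne_zero] at this
    have h2 := (norm_sub_norm_le _ _).trans this
    simp only [norm_pow, Complex.norm_natCast, MonoidHom.one_apply] at h2 ⊢
    linarith
  rw [← Finset.add_sum_erase _ _ (Finset.mem_univ (1 : MulChar (AdjoinRoot a) ℂ)),
    add_eq_zero_iff_eq_neg] at hzero
  rw [hzero, norm_neg] at hprinc
  have hrest : q ^ n - q ≤ ∑ χ ∈ Finset.univ.erase (1 : MulChar (AdjoinRoot a) ℂ),
      (‖mangoldtSum (charHom χ) n‖ + q) := by
    refine hprinc.trans (norm_sum_le_of_le _ fun χ _ => ?_)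
    rw [norm_mul]
    refine (mul_le_of_le_one_left (norm_nonneg _) (hbound χ)).trans ?_
    have h1 := norm_mangoldtSum_sub_le (norm_charHom_le_one ha0 χ) hp
    rw [norm_sub_rev] at h1
    linarith [norm_sub_norm_le (n * ∑ P ∈ irreduciblesOfDegree F n, charHom χ P)
      (mangoldtSum (charHom χ) n)]
  have hqn : 0 < q ^ n := by positivity
  have hmul := mul_lt_mul_of_pos_right hlt hqn
  have hc : q⁻¹ ^ n * q ^ n = 1 := by rw [← mul_pow, inv_mul_cancel₀ (by positivity), one_pow]
  have hdist : (∑ χ ∈ Finset.univ.erase (1 : MulChar (AdjoinRoot a) ℂ),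
      (‖mangoldtSum (charHom χ) n‖ / q ^ n + q * q⁻¹ ^ n)) * q ^ n =
      ∑ χ ∈ Finset.univ.erase (1 : MulChar (AdjoinRoot a) ℂ),
      (‖mangoldtSum (charHom χ) n‖ + q) := by
    rw [Finset.sum_mul]
    refine Finset.sum_congr rfl fun χ _ => ?_
    rw [add_mul, div_mul_cancel₀ _ hqn.ne', mul_assoc, hc, mul_one]
  rw [add_mul, hdist, mul_assoc, hc] at hmul
  linarith

end DirichletPolynomial

section FiniteFieldPowers

theorem mem_range_algebraMap_of_pow_card_eq {F K : Type*} [Field F] [Fintype F] [Field K]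
    [Algebra F K] {x : K} (hx : x ^ Fintype.card F = x) : x ∈ Set.range (algebraMap F K) := by
  classical
  by_contra hmem
  have hne : (X ^ Fintype.card F - X : K[X]) ≠ 0 :=
    FiniteField.X_pow_card_sub_X_ne_zero K Fintype.one_lt_card
  have hsub : (insert x (Finset.univ.image (algebraMap F K))).val ⊆
      (X ^ Fintype.card F - X : K[X]).roots := by
    intro y hy
    rw [mem_roots hne, IsRoot.def, eval_sub, eval_pow, eval_X, sub_eq_zero]
    rcases Finset.mem_insert.mp (Finset.mem_val.mp hy) with rfl | hy
    · exact hx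
    · obtain ⟨z, _, rfl⟩ := Finset.mem_image.mp hy
      rw [← map_pow, FiniteField.pow_card]
  have hcard := card_le_degree_of_subset_roots hsub
  rw [Finset.card_insert_of_notMem (by simpa using hmem),
    Finset.card_image_of_injective _ (algebraMap F K).injective, Finset.card_univ,
    FiniteField.X_pow_card_sub_X_natDegree_eq K Fintype.one_lt_card] at hcard
  omega

/-- In an extension of degree prime to `q - 1`, every nonzero element is a scalar times a
`(q - 1)`-th power. -/
theorem exists_eq_algebraMap_mul_pow {F K : Type*} [Field F] [Fintype F] [Field K] [Fintype K]
    [Algebra F K] {n : ℕ} (hK : Fintype.card K = Fintype.card F ^ n)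
    (hn : n.Coprime (Fintype.card F - 1)) {x : K} (hx : x ≠ 0) :
    ∃ (l : F) (u : K), l ≠ 0 ∧ u ≠ 0 ∧ x = algebraMap F K l * u ^ (Fintype.card F - 1) := by
  obtain ⟨r, hr⟩ : ∃ r, Fintype.card F = r + 1 :=
    Nat.exists_eq_succ_of_ne_zero Fintype.card_ne_zero
  rw [hr, Nat.add_sub_cancel] at hn ⊢
  set s := ∑ i ∈ Finset.range n, (r + 1) ^ i with hs
  have hsr : s * r + 1 = Fintype.card K := by rw [hK, hr, hs, geom_sum_mul_add]
  have hmod : s ≡ n [MOD r] := by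
    have h1 : s ≡ ∑ i ∈ Finset.range n, 1 ^ i [MOD r] :=
      Nat.ModEq.sum fun i _ => Nat.ModEq.pow i (by simp [Nat.ModEq])
    simpa using h1
  have hcop : IsCoprime (s : ℤ) (r : ℤ) := by
    rw [Nat.isCoprime_iff_coprime, Nat.Coprime, hmod.gcd_eq]
    exact hn
  obtain ⟨α, β, hαβ⟩ := hcop
  have hpow : (x ^ s) ^ Fintype.card F = x ^ s := by
    rw [hr, pow_succ, ← pow_mul, show s * r = Fintype.card K - 1 by omega,
      FiniteField.pow_card_sub_one_eq_one x hx, one_mul]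
  obtain ⟨μ, hμ⟩ := mem_range_algebraMap_of_pow_card_eq hpow
  have hμ0 : μ ≠ 0 := by
    rintro rfl
    rw [map_zero] at hμ
    exact pow_ne_zero s hx hμ.symm
  refine ⟨μ ^ α, x ^ β, zpow_ne_zero _ hμ0, zpow_ne_zero _ hx, ?_⟩
  rw [map_zpow₀, hμ, ← zpow_natCast, ← zpow_natCast, ← zpow_mul, ← zpow_mul, ← zpow_add₀ hx,
    mul_comm (s : ℤ), hαβ, zpow_one]

variable {F : Type*} [Field F] [Fintype F]

theorem card_adjoinRoot {b : F[X]} (hb : b ≠ 0) [Fintype (AdjoinRoot b)] :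
    Fintype.card (AdjoinRoot b) = Fintype.card F ^ b.natDegree := by
  have := (AdjoinRoot.powerBasis hb).finite
  rw [Module.card_eq_pow_finrank (K := F), (AdjoinRoot.powerBasis hb).finrank,
    AdjoinRoot.powerBasis_dim]

theorem dvd_pow_card_pow_sub {c u : F[X]} (hc : Irreducible c) (k : ℕ) :
    c ∣ u ^ (Fintype.card F ^ (c.natDegree * k)) - u := by
  have := Fact.mk hc
  have := finite_adjoinRoot hc.ne_zero
  have := Fintype.ofFinite (AdjoinRoot c)
  rw [← AdjoinRoot.mk_eq_mk, map_pow, pow_mul, ← card_adjoinRoot hc.ne_zero,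
    FiniteField.pow_card_pow]

theorem dvd_pow_sub_one_sub_pow {c u : F[X]} (hc : Irreducible c) (hu : ¬ c ∣ u) (i k : ℕ) :
    c ∣ u ^ (Fintype.card F ^ (i + c.natDegree * k) - 1) - u ^ (Fintype.card F ^ i - 1) := by
  have hpos (j : ℕ) : 1 ≤ Fintype.card F ^ j := Nat.one_le_pow _ _ Fintype.card_pos
  have h := dvd_pow_card_pow_sub hc k (u := u)
  have h1 : c ∣ u ^ (Fintype.card F ^ (i + c.natDegree * k)) - u ^ (Fintype.card F ^ i) := by
    rw [pow_add, mul_comm, pow_mul]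
    exact h.trans (sub_dvd_pow_sub_pow _ _ _)
  refine (hc.prime.dvd_or_dvd (b := u) (a := _) ?_).resolve_right hu
  rwa [sub_mul, pow_sub_one_mul (by have := hpos (i + c.natDegree * k); omega),
    pow_sub_one_mul (by have := hpos i; omega)]

/-- Modulo an irreducible polynomial of degree prime to `q - 1`, every polynomial is a scalar
times a `(q - 1)`-th power of a nonconstant polynomial. -/
theorem exists_dvd_sub_C_mul_pow {a b : F[X]} (hb : Irreducible b)
    (hn : b.natDegree.Coprime (Fintype.card F - 1)) (hab : ¬ b ∣ a) :
    ∃ (l : F) (u : F[X]), l ≠ 0 ∧ 0 < u.natDegree ∧ ¬ b ∣ u ∧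
      b ∣ a - C l * u ^ (Fintype.card F - 1) := by
  have := Fact.mk hb
  have := finite_adjoinRoot hb.ne_zero
  have := Fintype.ofFinite (AdjoinRoot b)
  obtain ⟨l, y, hl, hy, h⟩ := exists_eq_algebraMap_mul_pow (F := F)
    (card_adjoinRoot hb.ne_zero) hn (x := AdjoinRoot.mk b a)
    (by rwa [Ne, AdjoinRoot.mk_eq_zero])
  obtain ⟨w, rfl⟩ := AdjoinRoot.mk_surjective y
  have hlt : (w % b).natDegree < b.natDegree := natDegree_mod_lt w hb.natDegree_pos.ne'
  have hu : b ∣ (w % b + b) - w :=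
    ⟨1 - w / b, by linear_combination EuclideanDomain.div_add_mod w b⟩
  rw [← AdjoinRoot.mk_eq_mk] at hu
  refine ⟨l, w % b + b, hl, ?_, ?_, ?_⟩
  · rw [natDegree_add_eq_right_of_natDegree_lt hlt]
    exact hb.natDegree_pos
  · rwa [← AdjoinRoot.mk_eq_zero, hu]
  · rw [← AdjoinRoot.mk_eq_mk, map_mul, map_pow, hu, h, AdjoinRoot.mk_C, AdjoinRoot.algebraMap_eq]

end FiniteFieldPowers

section UnimodularRows

variable {R : Type*} [CommRing R]

theorem mul_upperElem_row (M : Matrix.SpecialLinearGroup (Fin 2) R) (x : R) :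
    (M * upperElem x).1 0 0 = M.1 0 0 ∧ (M * upperElem x).1 0 1 = M.1 0 1 + M.1 0 0 * x := by
  rw [Matrix.SpecialLinearGroup.coe_mul]
  simp [upperElem, Matrix.mul_apply, Fin.sum_univ_two, add_comm]

theorem mul_lowerElem_row (M : Matrix.SpecialLinearGroup (Fin 2) R) (x : R) :
    (M * lowerElem x).1 0 0 = M.1 0 0 + M.1 0 1 * x ∧ (M * lowerElem x).1 0 1 = M.1 0 1 := by
  rw [Matrix.SpecialLinearGroup.coe_mul]
  simp [lowerElem, Matrix.mul_apply, Fin.sum_univ_two]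

/-- Four elementary factors multiply to the diagonal matrix with entries `r` and `s = r⁻¹`. -/
theorem mul_diagonal_row (M : Matrix.SpecialLinearGroup (Fin 2) R) {r s : R} (h : r * s = 1) :
    (M * (upperElem (-r) * lowerElem (s - 1) * upperElem 1 * lowerElem (r - 1))).1 0 0 =
        M.1 0 0 * r ∧
      (M * (upperElem (-r) * lowerElem (s - 1) * upperElem 1 * lowerElem (r - 1))).1 0 1 =
        M.1 0 1 * s := by
  simp only [← mul_assoc, mul_upperElem_row, mul_lowerElem_row]
  constructor
  · linear_combination (-(M.1 0 0) * r + M.1 0 1) * h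
  · linear_combination (-(M.1 0 0)) * h

variable {F : Type*} [Field F] [Fintype F]

theorem exists_squareShift_row_of_irreducible (hq : Odd (Fintype.card F)) {a b : F[X]}
    (hb : Irreducible b) (hprime : b.natDegree.Prime)
    (hn : b.natDegree.Coprime (Fintype.card F - 1)) (hab : ¬ b ∣ a) :
    ∃ (l : F) (v : Fin 14 → F[X]) (M : Matrix.SpecialLinearGroup (Fin 2) F[X]), l ≠ 0 ∧
      M = squareShift (v 0) (v 1) (v 2) (v 3) (v 4) * squareShift (v 5) (v 6) (v 7) (v 8) (v 9)
        * (upperElem (v 10) * lowerElem (v 11) * upperElem (v 12)) * lowerElem (v 13) ∧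
      M.1 0 0 = C l⁻¹ * a ∧ M.1 0 1 = C l * b := by
  obtain ⟨l, u, hl, hu, hbu, hau⟩ := exists_dvd_sub_C_mul_pow hb hn hab
  have hll : (C l : F[X]) * C l⁻¹ = 1 := by rw [← C_mul, mul_inv_cancel₀ hl, C_1]
  have hcop : IsCoprime u (C l * b) :=
    (isCoprime_mul_unit_left_right (IsUnit.of_mul_eq_one _ hll) u b).mpr
      ((hb.coprime_iff_not_dvd.mpr hbu).symm)
  obtain ⟨α, β, hαβ⟩ := hcop
  obtain ⟨m₀, hm₀⟩ := exists_irreducible_dvd_sub hu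
    (b := -β) ⟨α, -(C l * b), by linear_combination hαβ⟩
  obtain ⟨m, hm, hmp⟩ := Nat.exists_infinite_primes (max m₀ (b.natDegree + 1))
  obtain ⟨c, -, hc, hcm, k, hk⟩ := hm₀ m (le_of_max_le_left hm) hmp
  have hdet : u * (α + C l * b * k) - C l * b * c = 1 := by
    linear_combination hαβ - C l * b * hk
  have hcu : ¬ c ∣ u := fun h => hc.not_dvd_one <| by
    rw [← hdet]
    exact dvd_sub (h.mul_right _) (dvd_mul_left _ _)
  have hmn : m.Coprime b.natDegree := (Nat.coprime_primes hmp hprime).mpr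
    (Nat.lt_of_succ_le (le_of_max_le_right hm)).ne'
  obtain ⟨N, hN₀, hN₁⟩ := Nat.chineseRemainder hmn 0 1
  obtain ⟨i, rfl⟩ := (Nat.modEq_zero_iff_dvd).mp hN₀
  have hpos : 1 ≤ m * i := by
    by_contra! h0
    rw [Nat.lt_one_iff.mp h0] at hN₁
    exact hprime.one_lt.ne' (Nat.dvd_one.mp ((Nat.modEq_zero_iff_dvd).mp hN₁.symm))
  obtain ⟨j, hj⟩ := (Nat.modEq_iff_dvd' hpos).mp hN₁.symm
  have hj' : m * i = 1 + b.natDegree * j := by omega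
  obtain ⟨h, hh⟩ : ∃ h, Fintype.card F ^ (m * i) - 1 = 2 * h := by
    obtain ⟨t, ht⟩ := hq.pow (n := m * i)
    exact ⟨t, by omega⟩
  have hc₁ : c ∣ u ^ (2 * h) - 1 := by
    simpa [hcm, hh] using dvd_pow_sub_one_sub_pow hc hcu 0 i
  have hb₁ : b ∣ u ^ (2 * h) - u ^ (Fintype.card F - 1) := by
    simpa [← hj', hh] using dvd_pow_sub_one_sub_pow hb hbu 1 j
  obtain ⟨v, M, hM, hM₀, hM₁⟩ := exists_squareShift_row hdet h hc₁
  obtain ⟨y₀, hy₀⟩ := hM₀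
  obtain ⟨y₁, hy₁⟩ := hb₁
  obtain ⟨y₂, hy₂⟩ := hau
  refine ⟨l, Fin.snoc v (-(y₀ + C l⁻¹ * y₁ - C l⁻¹ ^ 2 * y₂)),
    M * lowerElem (-(y₀ + C l⁻¹ * y₁ - C l⁻¹ ^ 2 * y₂)), hl,
    by rw [hM]; rfl, ?_, ?_⟩
  · rw [(mul_lowerElem_row _ _).1, hM₁]
    linear_combination hy₀ + hy₁ - C l⁻¹ * hy₂ -
      (b * y₁ - b * C l⁻¹ * y₂ + u ^ (Fintype.card F - 1)) * hll
  · rw [(mul_lowerElem_row _ _).2, hM₁]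

theorem exists_rowFamily_row (hq : Odd (Fintype.card F)) {a b : F[X]} (hab : IsCoprime a b) :
    ∃ v : Fin 52 → F[X], (rowFamily v).1 0 0 = a ∧ (rowFamily v).1 0 1 = b := by
  obtain ⟨x, hx⟩ : ∃ x, b + a * x ≠ 0 := by
    by_cases hb : b = 0
    · refine ⟨1, ?_⟩
      rw [hb, zero_add, mul_one]
      rintro rfl
      exact not_isCoprime_zero_zero (hb ▸ hab)
    · exact ⟨0, by simpa using hb⟩
  obtain ⟨y, hy⟩ : ∃ y, 0 < (a + (b + a * x) * y).natDegree := by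
    by_cases ha : 0 < a.natDegree
    · exact ⟨0, by simpa using ha⟩
    · refine ⟨X, ?_⟩
      have hX := natDegree_mul_X hx
      rw [natDegree_add_eq_right_of_natDegree_lt (by omega)]
      omega
  have hcop : IsCoprime (a + (b + a * x) * y) (b + a * x) :=
    (hab.add_mul_left_right x).add_mul_left_left y
  obtain ⟨n₀, hn₀⟩ := exists_irreducible_dvd_sub hy hcop
  obtain ⟨n, hn, hprime⟩ := Nat.exists_infinite_primes (max n₀ (Fintype.card F))
  obtain ⟨P, -, hP, rfl, z, hz⟩ := hn₀ n (le_of_max_le_left hn) hprime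
  have hq1 : 1 < Fintype.card F := Fintype.one_lt_card
  have hndvd : ¬ P ∣ a + (b + a * x) * y := by
    rw [← hP.coprime_iff_not_dvd, show P = b + a * x + (a + (b + a * x) * y) * z by
      linear_combination hz]
    exact (hcop.add_mul_left_right z).symm
  obtain ⟨l, v, M, hl, hM, hM₀, hM₁⟩ := exists_squareShift_row_of_irreducible hq hP hprime
    ((Nat.Prime.coprime_iff_not_dvd hprime).mpr fun h => by
      have := Nat.le_of_dvd (by omega) h
      have := le_of_max_le_right hn
      omega) hndvd
  have hll : (C l : F[X]) * C l⁻¹ = 1 := by rw [← C_mul, mul_inv_cancel₀ hl, C_1]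
  set w : Fin 52 → F[X] := fun i => [v 0, v 1, v 2, v 3, v 4, v 5, v 6, v 7, v 8, v 9, v 10, v 11,
    v 12, v 13, -C l, C l⁻¹ - 1, 1, C l - 1, -z, -y, -x].getD i 0 with hw
  have hrow : rowFamily w = M *
      (upperElem (-C l) * lowerElem (C l⁻¹ - 1) * upperElem 1 * lowerElem (C l - 1)) *
      upperElem (-z) * lowerElem (-y) * upperElem (-x) := by
    rw [hM]
    simp only [mul_assoc]
    simp only [rowFamily, mul_assoc]
    rfl
  refine ⟨w, ?_⟩
  rw [hrow]
  simp only [mul_upperElem_row, mul_lowerElem_row, (mul_diagonal_row M hll).1,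
    (mul_diagonal_row M hll).2, hM₀, hM₁]
  constructor
  · linear_combination (a + (b + a * x) * y - P * y + (a + (b + a * x) * y) * z * y) * hll - y * hz
  · linear_combination (P - (a + (b + a * x) * y) * z - x * (a + (b + a * x) * y - P * y +
      (a + (b + a * x) * y) * z * y)) * hll + (1 + x * y) * hz

end UnimodularRows

/-- **UM₂(𝔽_q[T]) is a polynomial family with 52 parameters.**
Here `F` is a finite field whose cardinality is odd (i.e. a power of an odd prime `p`),
and `A = F[T]`.  `UM₂(A)` is the set of unimodular pairs `(a, b) ∈ A²`, i.e. those
pairs for which there exist `c, d ∈ A` with `a·d − b·c = 1`. -/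
theorem um2_polynomial_family_52
    (F : Type) [Field F] [Fintype F] (hq : Odd (Fintype.card F)) :
    ∃ P₁ P₂ : MvPolynomial (Fin 52) (Polynomial F),
      {x : Polynomial F × Polynomial F |
          ∃ c d : Polynomial F, x.1 * d - x.2 * c = 1} =
        Set.range (fun v : Fin 52 → Polynomial F =>
          (MvPolynomial.eval v P₁, MvPolynomial.eval v P₂)) := by
  let M : Matrix.SpecialLinearGroup (Fin 2) (MvPolynomial (Fin 52) F[X]) :=
    rowFamily MvPolynomial.X
  have heval (v : Fin 52 → F[X]) (i j : Fin 2) :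
      MvPolynomial.eval v (M.1 i j) = (rowFamily v).1 i j := by
    have h := map_rowFamily (MvPolynomial.eval v) MvPolynomial.X
    simp only [MvPolynomial.eval_X] at h
    rw [← h]
    rfl
  refine ⟨M.1 0 0, M.1 0 1, ?_⟩
  ext ⟨a, b⟩
  simp only [Set.mem_ofPred_eq, Set.mem_range, heval, Prod.mk.injEq]
  constructor
  · rintro ⟨c, d, h⟩
    exact exists_rowFamily_row hq ⟨d, -c, by linear_combination h⟩
  · rintro ⟨v, rfl, rfl⟩
    refine ⟨(rowFamily v).1 1 0, (rowFamily v).1 1 1, ?_⟩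
    rw [← Matrix.det_fin_two]
    exact (rowFamily v).2
end
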